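/- Let p ∈ (1,∞), let Ω ⊆ ℝ^d be a domain, and let V₁, V₂ ∈ L^∞_loc(Ω) be real-valued with V₁ ≤ V₂ a.e. in Ω and V₁ ≠ V₂ on a set of positive Lebesgue measure. If Q_{V₁} is nonnegative in Ω, then Q_{V₂} is subcritical in Ω. -/

import Mathlib

open MeasureTheory Filter
open scoped Topology RealInnerProductSpace

noncomputable section

abbrev Ed (d : ℕ) := EuclideanSpace ℝ (Fin d)

/-- A smooth test function compactly supported inside Ω. -/
def IsTestOn {d : ℕ} (Ω : Set (Ed d)) (u : Ed d → ℝ) : Prop :=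
  ContDiff ℝ (⊤ : ℕ∞) u ∧ HasCompactSupport u ∧ tsupport u ⊆ Ω

/-- `V ∈ L^∞_loc(Ω)`. -/
def LocBddOn {d : ℕ} (Ω : Set (Ed d)) (V : Ed d → ℝ) : Prop :=
  Measurable V ∧ ∀ K : Set (Ed d), IsCompact K → K ⊆ Ω →
    ∃ M : ℝ, ∀ᵐ x ∂(volume : Measure (Ed d)), x ∈ K → |V x| ≤ M

/-- The functional `Q_V(u) = ∫_Ω (|∇u|^p + V|u|^p) dx`. -/
def Qp {d : ℕ} (p : ℝ) (Ω : Set (Ed d)) (V : Ed d → ℝ) (u : Ed d → ℝ) : ℝ :=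
  ∫ x in Ω, (‖gradient u x‖ ^ p + V x * |u x| ^ p)

/-- `Q_V` is nonnegative in Ω. -/
def NonnegOn {d : ℕ} (p : ℝ) (Ω : Set (Ed d)) (V : Ed d → ℝ) : Prop :=
  ∀ u, IsTestOn Ω u → 0 ≤ Qp p Ω V u

/-- `Q_V` is subcritical (strictly positive) in Ω: there is a continuous function
`W > 0` on Ω with `Q_V(u) ≥ ∫_Ω W|u|^p` for all test functions `u`. -/
def SubcriticalOn {d : ℕ} (p : ℝ) (Ω : Set (Ed d)) (V : Ed d → ℝ) : Prop :=
  ∃ W : Ed d → ℝ, ContinuousOn W Ω ∧ (∀ x ∈ Ω, 0 < W x) ∧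
    ∀ u, IsTestOn Ω u → (∫ x in Ω, W x * |u x| ^ p) ≤ Qp p Ω V u

/-- A null sequence for `Q_V` in Ω. -/
def NullSeqOn {d : ℕ} (p : ℝ) (Ω : Set (Ed d)) (V : Ed d → ℝ)
    (un : ℕ → Ed d → ℝ) : Prop :=
  (∀ n, IsTestOn Ω (un n)) ∧ (∀ n x, 0 ≤ un n x) ∧
  (∃ B : Set (Ed d), IsOpen B ∧ IsCompact (closure B) ∧ closure B ⊆ Ω ∧
    ∀ n, (∫ x in B, |un n x| ^ p) = 1) ∧
  Tendsto (fun n => Qp p Ω V (un n)) atTop (𝓝 0)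

/-- A ground state of `Q_V` in Ω: a positive C¹ function on Ω that is the limit of
a null sequence in `L^p(K)` for every compact `K ⊆ Ω`. -/
def IsGroundStateOn {d : ℕ} (p : ℝ) (Ω : Set (Ed d)) (V : Ed d → ℝ)
    (φ : Ed d → ℝ) : Prop :=
  ContDiffOn ℝ 1 φ Ω ∧ (∀ x ∈ Ω, 0 < φ x) ∧
  ∃ un, NullSeqOn p Ω V un ∧ ∀ K : Set (Ed d), IsCompact K → K ⊆ Ω →
    Tendsto (fun n => ∫ x in K, |un n x - φ x| ^ p) atTop (𝓝 0)

/-- `Q_V` is critical in Ω. -/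
def CriticalOn {d : ℕ} (p : ℝ) (Ω : Set (Ed d)) (V : Ed d → ℝ) : Prop :=
  NonnegOn p Ω V ∧ ∃ φ, IsGroundStateOn p Ω V φ

/-- A positive weak supersolution of `-Δ_p v + V|v|^{p-2}v = 0` in Ω. -/
def IsSupersolOn {d : ℕ} (p : ℝ) (Ω : Set (Ed d)) (V : Ed d → ℝ)
    (v : Ed d → ℝ) : Prop :=
  ContDiffOn ℝ 1 v Ω ∧ (∀ x ∈ Ω, 0 < v x) ∧
  ∀ φ, IsTestOn Ω φ → (∀ x, 0 ≤ φ x) →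
    0 ≤ ∫ x in Ω, (‖gradient v x‖ ^ (p - 2) * ⟪gradient v x, gradient φ x⟫ +
      V x * v x ^ (p - 1) * φ x)

/-- A positive weak solution of `-Δ_p v + V|v|^{p-2}v = 0` in Ω. -/
def IsSolOn {d : ℕ} (p : ℝ) (Ω : Set (Ed d)) (V : Ed d → ℝ)
    (v : Ed d → ℝ) : Prop :=
  ContDiffOn ℝ 1 v Ω ∧ (∀ x ∈ Ω, 0 < v x) ∧
  ∀ φ, IsTestOn Ω φ →
    (∫ x in Ω, (‖gradient v x‖ ^ (p - 2) * ⟪gradient v x, gradient φ x⟫ +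
      V x * v x ^ (p - 1) * φ x)) = 0

lemma aux_lint_affine {d : ℕ} (g : Ed d → ENNReal) (hg : Measurable g) (t : ℝ)
    (ht : 1 / 2 ≤ t) (a : Ed d) :
    ∫⁻ y, g (a + t • y) ≤ 2 ^ d * ∫⁻ z, g z := by
  have ht0 : t ≠ 0 := by linarith [show (0:ℝ) < 1/2 by norm_num]
  have ht1 : 0 < t := by linarith [show (0:ℝ) < 1/2 by norm_num]
  have h1 : ∫⁻ y, g (a + t • y) = ∫⁻ z, g (a + z) ∂(Measure.map (fun y : Ed d => t • y) volume) := by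
    rw [lintegral_map (by fun_prop) (by fun_prop)]
  rw [h1, Measure.map_addHaar_smul _ ht0, lintegral_smul_measure, lintegral_add_left_eq_self]
  rw [smul_eq_mul]
  gcongr
  have : (2:ENNReal)^d = ENNReal.ofReal (2^d) := by
    rw [ENNReal.ofReal_pow (by norm_num)]; simp
  rw [this]
  apply ENNReal.ofReal_le_ofReal
  rw [finrank_euclideanSpace_fin, abs_inv, abs_pow, abs_of_pos ht1, ← inv_pow]
  gcongr
  rw [inv_le_comm₀ ht1 (by norm_num)]
  linarith

lemma aux_seg {d : ℕ} {p : ℝ} (hp : 1 < p) (f : Ed d → ℝ) (hf : ContDiff ℝ 1 f)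
    (x y : Ed d) :
    ENNReal.ofReal (|f x - f y| ^ p) ≤ ENNReal.ofReal (dist x y ^ p) *
      ∫⁻ t in Set.Icc (0:ℝ) 1, ENNReal.ofReal (‖fderiv ℝ f (x + t • (y - x))‖ ^ p) := by
  have hcf : Continuous (fderiv ℝ f) := hf.continuous_fderiv (by norm_num)
  set F : ℝ → ℝ := fun t => ‖fderiv ℝ f (x + t • (y - x))‖ with hF
  have hFc : Continuous F := by rw [hF]; fun_prop
  have hd : ∀ t : ℝ, HasDerivAt (fun t => f (x + t • (y - x)))
      (fderiv ℝ f (x + t • (y - x)) (y - x)) t := by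
    intro t
    have h1 : HasDerivAt (fun t : ℝ => x + t • (y - x)) (y - x) t := by
      simpa using ((hasDerivAt_id t).smul_const (y - x)).const_add x
    exact ((hf.differentiable (by norm_num)) _).hasFDerivAt.comp_hasDerivAt t h1
  have hdc : Continuous (fun t : ℝ => fderiv ℝ f (x + t • (y - x)) (y - x)) := by fun_prop
  have hftc := intervalIntegral.integral_eq_sub_of_hasDerivAt (a := 0) (b := 1)
    (fun t _ => hd t) (hdc.intervalIntegrable _ _)
  simp only [one_smul, zero_smul, add_zero, add_sub_cancel] at hftc
  have hb : |f x - f y| ≤ dist x y * ∫ t in Set.Icc (0:ℝ) 1, F t := by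
    rw [abs_sub_comm, ← hftc, ← Real.norm_eq_abs]
    refine (intervalIntegral.norm_integral_le_integral_norm (by norm_num)).trans ?_
    rw [integral_Icc_eq_integral_Ioc, ← intervalIntegral.integral_of_le (by norm_num),
      ← intervalIntegral.integral_const_mul]
    apply intervalIntegral.integral_mono_on (by norm_num)
      (hdc.norm.intervalIntegrable _ _) ((hFc.const_mul _).intervalIntegrable _ _)
    intro t _
    refine (ContinuousLinearMap.le_opNorm _ _).trans ?_
    rw [mul_comm, dist_comm, dist_eq_norm]
  have hpm : IsProbabilityMeasure (volume.restrict (Set.Icc (0:ℝ) 1)) := by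
    constructor; simp
  have hI1 : Integrable F (volume.restrict (Set.Icc (0:ℝ) 1)) :=
    hFc.continuousOn.integrableOn_Icc
  have hFpc : Continuous (fun t => F t ^ p) := hFc.rpow_const (fun _ => Or.inr (by linarith))
  have hI2 : Integrable (fun t => F t ^ p) (volume.restrict (Set.Icc (0:ℝ) 1)) :=
    hFpc.continuousOn.integrableOn_Icc
  have hJ := ConvexOn.map_integral_le (convexOn_rpow hp.le)
    (ContinuousOn.rpow_const continuousOn_id (fun _ _ => Or.inr (by linarith)))
    isClosed_Ici (Eventually.of_forall (fun t => norm_nonneg _)) hI1 hI2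
  have hI0 : 0 ≤ ∫ t in Set.Icc (0:ℝ) 1, F t := integral_nonneg (fun t => norm_nonneg _)
  rw [← ofReal_integral_eq_lintegral_ofReal hI2
    (Eventually.of_forall (fun t => by positivity)), ← ENNReal.ofReal_mul (by positivity)]
  apply ENNReal.ofReal_le_ofReal
  calc |f x - f y| ^ p ≤ (dist x y * ∫ t in Set.Icc (0:ℝ) 1, F t) ^ p := by
        gcongr
    _ = dist x y ^ p * (∫ t in Set.Icc (0:ℝ) 1, F t) ^ p := by
        rw [Real.mul_rpow dist_nonneg hI0]
    _ ≤ _ := by gcongr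

lemma aux_poincare {d : ℕ} {p : ℝ} (hp : 1 < p) (f : Ed d → ℝ) (hf : ContDiff ℝ 1 f)
    (x0 : Ed d) {r : ℝ} (hr : 0 < r) :
    ∫⁻ x in Metric.ball x0 r, ∫⁻ y in Metric.ball x0 r, ENNReal.ofReal (|f x - f y| ^ p) ≤
      ENNReal.ofReal ((2 * r) ^ p) * (2 ^ d * volume (Metric.ball x0 r) *
        ∫⁻ z in Metric.ball x0 r, ENNReal.ofReal (‖fderiv ℝ f z‖ ^ p)) := by
  have hcf : Continuous (fderiv ℝ f) := hf.continuous_fderiv (by norm_num)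
  have hp0 : 0 ≤ p := by linarith
  set B := Metric.ball x0 r with hB
  have hBm : MeasurableSet B := Metric.isOpen_ball.measurableSet
  set g0 : Ed d → ENNReal := fun z => ENNReal.ofReal (‖fderiv ℝ f z‖ ^ p) with hg0
  have hg0m : Measurable g0 :=
    ((hcf.norm.rpow_const (fun _ => Or.inr hp0)).measurable).ennreal_ofReal
  set g : Ed d → ENNReal := B.indicator g0 with hg
  have hgm : Measurable g := hg0m.indicator hBm
  have hgint : ∫⁻ z, g z = ∫⁻ z in B, g0 z := lintegral_indicator hBm _
  have hstep : ∀ x ∈ B, ∀ y ∈ B, ENNReal.ofReal (|f x - f y| ^ p) ≤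
      ENNReal.ofReal ((2 * r) ^ p) * ∫⁻ t in Set.Icc (0:ℝ) 1, g (x + t • (y - x)) := by
    intro x hx y hy
    refine (aux_seg hp f hf x y).trans ?_
    refine mul_le_mul' ?_ ?_
    · apply ENNReal.ofReal_le_ofReal
      have : dist x y ≤ 2 * r := by
        have h1 := dist_triangle_right x y x0
        rw [hB, Metric.mem_ball] at hx hy
        linarith
      gcongr
    · refine setLIntegral_mono' measurableSet_Icc ?_
      intro t ht
      have : x + t • (y - x) ∈ B := (convex_ball x0 r).add_smul_sub_mem hx hy ht
      simp [hg, this, hg0]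
  have key : ∀ t ∈ Set.Icc (0:ℝ) 1, ∫⁻ x in B, ∫⁻ y in B, g (x + t • (y - x)) ≤
      2 ^ d * volume B * ∫⁻ z, g z := by
    intro t ht
    by_cases h : 1 / 2 ≤ t
    · calc ∫⁻ x in B, ∫⁻ y in B, g (x + t • (y - x))
          ≤ ∫⁻ x in B, 2 ^ d * ∫⁻ z, g z := by
            refine lintegral_mono fun x => ?_
            refine (setLIntegral_le_lintegral _ _).trans ?_
            refine le_trans (le_of_eq ?_) (aux_lint_affine g hgm t h ((1 - t) • x))
            congr 1; ext y; congr 1; module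
        _ = _ := by rw [setLIntegral_const]; ring
    · have h' : 1 / 2 ≤ 1 - t := by linarith
      rw [lintegral_lintegral_swap (by
        apply Measurable.aemeasurable
        exact hgm.comp (by fun_prop))]
      calc ∫⁻ y in B, ∫⁻ x in B, g (x + t • (y - x))
          ≤ ∫⁻ x in B, 2 ^ d * ∫⁻ z, g z := by
            refine lintegral_mono fun y => ?_
            refine (setLIntegral_le_lintegral _ _).trans ?_
            refine le_trans (le_of_eq ?_) (aux_lint_affine g hgm (1 - t) h' (t • y))
            congr 1; ext x; congr 1; module
        _ = _ := by rw [setLIntegral_const]; ring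
  calc ∫⁻ x in B, ∫⁻ y in B, ENNReal.ofReal (|f x - f y| ^ p)
      ≤ ∫⁻ x in B, ∫⁻ y in B, ENNReal.ofReal ((2 * r) ^ p) *
          ∫⁻ t in Set.Icc (0:ℝ) 1, g (x + t • (y - x)) :=
        setLIntegral_mono' hBm fun x hx => setLIntegral_mono' hBm fun y hy => hstep x hx y hy
    _ = ENNReal.ofReal ((2 * r) ^ p) * ∫⁻ x in B, ∫⁻ y in B,
          ∫⁻ t in Set.Icc (0:ℝ) 1, g (x + t • (y - x)) := by
        rw [← lintegral_const_mul' _ _ ENNReal.ofReal_ne_top]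
        congr 1; ext x
        rw [← lintegral_const_mul' _ _ ENNReal.ofReal_ne_top]
    _ = ENNReal.ofReal ((2 * r) ^ p) * ∫⁻ t in Set.Icc (0:ℝ) 1, ∫⁻ x in B, ∫⁻ y in B,
          g (x + t • (y - x)) := by
        congr 1
        have hm3 : Measurable (fun q : (Ed d × ℝ) × Ed d => g (q.1.1 + q.1.2 • (q.2 - q.1.1))) :=
          hgm.comp (by fun_prop)
        rw [← lintegral_lintegral_swap (f := fun x t => ∫⁻ y in B, g (x + t • (y - x)))]
        · congr 1; ext x
          rw [lintegral_lintegral_swap]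
          exact (hgm.comp (by fun_prop)).aemeasurable
        · exact (Measurable.lintegral_prod_right (ν := volume.restrict B) hm3).aemeasurable
    _ ≤ ENNReal.ofReal ((2 * r) ^ p) * ∫⁻ t in Set.Icc (0:ℝ) 1, 2 ^ d * volume B * ∫⁻ z, g z := by
        refine mul_le_mul' le_rfl ?_
        exact setLIntegral_mono' measurableSet_Icc key
    _ = _ := by
        rw [setLIntegral_const, hgint]; simp

/-- Measure form of Poincare. -/
lemma aux_meas {d : ℕ} {p : ℝ} (hp : 1 < p) (f : Ed d → ℝ) (hf : ContDiff ℝ 1 f)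
    (x0 : Ed d) {r : ℝ} (hr : 0 < r) (a N : ℝ) (hN : 0 ≤ N) :
    ENNReal.ofReal (N ^ p) * (volume (Metric.ball x0 r ∩ {x | f x ≤ a}) *
      volume (Metric.ball x0 r ∩ {x | a + N < f x})) ≤
      ENNReal.ofReal ((2 * r) ^ p) * (2 ^ d * volume (Metric.ball x0 r) *
        ∫⁻ z in Metric.ball x0 r, ENNReal.ofReal (‖fderiv ℝ f z‖ ^ p)) := by
  refine le_trans ?_ (aux_poincare hp f hf x0 hr)
  have hfc : Continuous f := hf.continuous
  set S := Metric.ball x0 r ∩ {x | f x ≤ a} with hS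
  set T := Metric.ball x0 r ∩ {x | a + N < f x} with hT
  have hSm : MeasurableSet S :=
    Metric.isOpen_ball.measurableSet.inter (isClosed_le hfc continuous_const).measurableSet
  have hTm : MeasurableSet T :=
    Metric.isOpen_ball.measurableSet.inter (isOpen_lt continuous_const hfc).measurableSet
  calc _ = ∫⁻ x in S, ∫⁻ y in T, ENNReal.ofReal (N ^ p) := by
        rw [setLIntegral_const, setLIntegral_const]; ring
    _ ≤ ∫⁻ x in S, ∫⁻ y in T, ENNReal.ofReal (|f x - f y| ^ p) := by
        refine setLIntegral_mono' hSm fun x hx => setLIntegral_mono' hTm fun y hy => ?_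
        apply ENNReal.ofReal_le_ofReal
        have h1 : f x ≤ a := hx.2
        have h2 : a + N < f y := hy.2
        have : N ≤ |f x - f y| := by
          rw [abs_sub_comm]; exact le_trans (by linarith) (le_abs_self _)
        gcongr
    _ ≤ ∫⁻ x in S, ∫⁻ y in Metric.ball x0 r, ENNReal.ofReal (|f x - f y| ^ p) :=
        lintegral_mono fun x => lintegral_mono_set Set.inter_subset_left
    _ ≤ _ := lintegral_mono_set Set.inter_subset_left

lemma aux_lp {d : ℕ} {p : ℝ} (hp : 1 < p) (u : Ed d → ℝ) (hu : ContDiff ℝ 1 u)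
    (x0 : Ed d) {r : ℝ} (hr : 0 < r) (m : ENNReal)
    (hG : volume (Metric.ball x0 r) ≤
      2 * volume (Metric.ball x0 r ∩ {x | ENNReal.ofReal (|u x| ^ p) ≤ m})) :
    ∫⁻ x in Metric.ball x0 r, ENNReal.ofReal (|u x| ^ p) ≤
      ENNReal.ofReal (2 ^ (p - 1)) * (ENNReal.ofReal ((2 * r) ^ p) * (2 ^ d * 2 *
        ∫⁻ z in Metric.ball x0 r, ENNReal.ofReal (‖fderiv ℝ u z‖ ^ p))
        + volume (Metric.ball x0 r) * m) := by
  have huc : Continuous u := hu.continuous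
  have hp0 : 0 ≤ p := by linarith
  have hum : Measurable (fun x => ENNReal.ofReal (|u x| ^ p)) :=
    ((huc.abs.rpow_const (fun _ => Or.inr hp0)).measurable).ennreal_ofReal
  set B := Metric.ball x0 r with hB
  set G := B ∩ {x | ENNReal.ofReal (|u x| ^ p) ≤ m} with hGdef
  have hGm : MeasurableSet G :=
    Metric.isOpen_ball.measurableSet.inter (measurableSet_le hum measurable_const)
  have hB0 : 0 < volume B := Metric.measure_ball_pos _ _ hr
  have hBt : volume B ≠ ⊤ := measure_ball_lt_top.ne
  have hG0 : volume G ≠ 0 := by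
    intro h; rw [h, mul_zero] at hG; exact absurd hG (not_le.2 hB0)
  have hGt : volume G ≠ ⊤ := ne_top_of_le_ne_top hBt (measure_mono Set.inter_subset_left)
  set c := ENNReal.ofReal (2 ^ (p - 1)) with hc
  have hpt : ∀ x, ∀ y ∈ G, ENNReal.ofReal (|u x| ^ p) ≤
      c * (ENNReal.ofReal (|u x - u y| ^ p) + m) := by
    intro x y hy
    have h1 : |u x| ^ p ≤ 2 ^ (p - 1) * (|u x - u y| ^ p + |u y| ^ p) := by
      have h2 : |u x| ≤ |u x - u y| + |u y| := by
        have := abs_add_le (u x - u y) (u y); simpa using this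
      calc |u x| ^ p ≤ (|u x - u y| + |u y|) ^ p := by gcongr
        _ ≤ _ := by
            have h3 := NNReal.rpow_add_le_mul_rpow_add_rpow ⟨|u x - u y|, abs_nonneg _⟩
              ⟨|u y|, abs_nonneg _⟩ hp.le
            exact_mod_cast h3
    refine (ENNReal.ofReal_le_ofReal h1).trans ?_
    rw [ENNReal.ofReal_mul (by positivity), ENNReal.ofReal_add (by positivity) (by positivity)]
    gcongr
    exact hy.2
  have hmain : volume G * ∫⁻ x in B, ENNReal.ofReal (|u x| ^ p) ≤
      c * ((ENNReal.ofReal ((2 * r) ^ p) * (2 ^ d * volume B *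
        ∫⁻ z in B, ENNReal.ofReal (‖fderiv ℝ u z‖ ^ p))) + volume B * (m * volume G)) := by
    calc volume G * ∫⁻ x in B, ENNReal.ofReal (|u x| ^ p)
        = ∫⁻ x in B, ∫⁻ y in G, ENNReal.ofReal (|u x| ^ p) := by
          rw [← lintegral_const_mul _ hum]
          congr 1; ext x; rw [setLIntegral_const, mul_comm]
      _ ≤ ∫⁻ x in B, ∫⁻ y in G, c * (ENNReal.ofReal (|u x - u y| ^ p) + m) :=
          lintegral_mono fun x => setLIntegral_mono' hGm fun y hy => hpt x y hy
      _ = c * ((∫⁻ x in B, ∫⁻ y in G, ENNReal.ofReal (|u x - u y| ^ p))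
            + volume B * (m * volume G)) := by
          rw [← setLIntegral_const G m, mul_comm (volume B), ← setLIntegral_const B,
            ← lintegral_add_right _ measurable_const,
            ← lintegral_const_mul' _ _ ENNReal.ofReal_ne_top]
          congr 1; ext x
          rw [lintegral_const_mul' _ _ ENNReal.ofReal_ne_top,
            lintegral_add_right _ measurable_const]
      _ ≤ _ := by
          gcongr
          refine le_trans ?_ (aux_poincare hp u hu x0 hr)
          exact lintegral_mono fun x => lintegral_mono_set Set.inter_subset_left
  set D := ∫⁻ z in B, ENNReal.ofReal (‖fderiv ℝ u z‖ ^ p) with hD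
  have h2 : volume G * ∫⁻ x in B, ENNReal.ofReal (|u x| ^ p) ≤
      volume G * (c * (ENNReal.ofReal ((2 * r) ^ p) * (2 ^ d * 2 * D) + volume B * m)) := by
    refine hmain.trans ?_
    calc _ ≤ c * ((ENNReal.ofReal ((2 * r) ^ p) * (2 ^ d * (2 * volume G) * D))
          + volume B * (m * volume G)) := by gcongr
      _ = _ := by ring
  exact (ENNReal.mul_le_mul_iff_right hG0 hGt).1 h2

/-- averaging over centers -/
lemma aux_avg_lower {d : ℕ} (h : Ed d → ENNReal) (hh : Measurable h) (x0 : Ed d) {ρ l : ℝ}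
    (hl : 0 < l) :
    volume (Metric.ball x0 l) * ∫⁻ x in Metric.ball x0 ρ, h x ≤
      ∫⁻ y in Metric.ball x0 (ρ + l), ∫⁻ x in Metric.ball y l, h x ∧
    ∫⁻ y in Metric.ball x0 (ρ + l), ∫⁻ x in Metric.ball y l, h x ≤
      volume (Metric.ball x0 l) * ∫⁻ x in Metric.ball x0 (ρ + 2 * l), h x := by
  have hmB : ∀ (y : Ed d) (r : ℝ), MeasurableSet (Metric.ball y r) :=
    fun y r => Metric.isOpen_ball.measurableSet
  have hvol : ∀ y : Ed d, volume (Metric.ball y l) = volume (Metric.ball x0 l) := by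
    intro y
    rw [Measure.addHaar_ball_center, Measure.addHaar_ball_center volume x0]
  have hset : MeasurableSet {q : Ed d × Ed d | dist q.2 q.1 < l} :=
    (isOpen_lt (by fun_prop) continuous_const).measurableSet
  have hmm : Measurable (fun q : Ed d × Ed d => (Metric.ball q.1 l).indicator h q.2) := by
    have : (fun q : Ed d × Ed d => (Metric.ball q.1 l).indicator h q.2) =
        {q : Ed d × Ed d | dist q.2 q.1 < l}.indicator (fun q => h q.2) := by
      ext q; simp [Set.indicator, Metric.mem_ball]
    rw [this]
    exact (hh.comp measurable_snd).indicator hset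
  have heq : ∫⁻ y in Metric.ball x0 (ρ + l), ∫⁻ x in Metric.ball y l, h x =
      ∫⁻ x, ∫⁻ y in Metric.ball x0 (ρ + l), (Metric.ball y l).indicator h x := by
    rw [lintegral_lintegral_swap]
    · congr 1; ext y; rw [lintegral_indicator (hmB _ _)]
    · exact (hmm.comp measurable_swap).aemeasurable
  have hswap : ∀ x y : Ed d, (Metric.ball y l).indicator h x =
      (Metric.ball x l).indicator (fun _ => h x) y := by
    intro x y; simp [Set.indicator, Metric.mem_ball, dist_comm]
  have hin : ∀ x : Ed d, ∫⁻ y in Metric.ball x0 (ρ + l), (Metric.ball y l).indicator h x =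
      h x * volume (Metric.ball x l ∩ Metric.ball x0 (ρ + l)) := by
    intro x
    simp_rw [hswap x]
    rw [lintegral_indicator (hmB _ _), setLIntegral_const, Measure.restrict_apply (hmB _ _)]
  rw [heq]
  simp_rw [hin]
  constructor
  · rw [← lintegral_const_mul _ hh]
    refine le_trans ?_ (setLIntegral_le_lintegral (Metric.ball x0 ρ) _)
    refine setLIntegral_mono' (hmB _ _) fun x hx => ?_
    have hs : Metric.ball x l ⊆ Metric.ball x0 (ρ + l) := by
      apply Metric.ball_subset_ball'
      rw [Metric.mem_ball] at hx; linarith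
    rw [mul_comm, Set.inter_eq_left.2 hs, hvol x]
  · rw [← lintegral_const_mul _ hh, ← lintegral_indicator (hmB _ _)]
    refine lintegral_mono fun x => ?_
    by_cases hx : x ∈ Metric.ball x0 (ρ + 2 * l)
    · rw [Set.indicator_of_mem hx, mul_comm]
      refine mul_le_mul' ?_ le_rfl
      rw [← hvol x]; exact measure_mono Set.inter_subset_left
    · have : Metric.ball x l ∩ Metric.ball x0 (ρ + l) = ∅ := by
        ext y
        simp only [Set.mem_inter_iff, Metric.mem_ball, Set.mem_empty_iff_false, iff_false,
          not_and]
        intro h1 h2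
        apply hx
        rw [Metric.mem_ball]
        have := dist_triangle_left x x0 y
        linarith
      simp [this]

lemma aux_real {p τ a b C : ℝ} (hp : 1 < p) (h0 : 0 ≤ τ) (h1 : τ ≤ 1) (ha : 0 ≤ a) (hb : 0 ≤ b)
    (hC : 0 ≤ C) (h : b ^ p ≤ C * τ ^ (p - 1)) :
    ((1 - τ) * a + b) ^ p ≤ (1 - τ) * a ^ p + C := by
  rcases h0.eq_or_lt with h0 | h0
  · subst h0
    rw [Real.zero_rpow (by linarith), mul_zero] at h
    have hb0 : b = 0 := by
      by_contra hne
      have : 0 < b ^ p := Real.rpow_pos_of_pos (lt_of_le_of_ne hb (Ne.symm hne)) _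
      linarith
    subst hb0; simp; exact hC
  · have h1' : 0 ≤ 1 - τ := by linarith
    have hcv := (convexOn_rpow hp.le).2 (show a ∈ Set.Ici (0:ℝ) from ha)
      (show b / τ ∈ Set.Ici (0:ℝ) from div_nonneg hb h0.le) h1' h0.le (by ring)
    simp only [smul_eq_mul] at hcv
    rw [mul_div_cancel₀ _ h0.ne'] at hcv
    refine hcv.trans ?_
    have : τ * (b / τ) ^ p ≤ C := by
      rw [Real.div_rpow hb h0.le, ← mul_div_assoc, div_le_iff₀ (by positivity)]
      calc τ * b ^ p ≤ τ * (C * τ ^ (p - 1)) := by gcongr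
        _ = C * (τ ^ (p - 1) * τ) := by ring
        _ = C * τ ^ p := by rw [← Real.rpow_add_one h0.ne']; ring_nf
    linarith

lemma aux_smoothTransition_bdd : ∃ A : ℝ, 0 < A ∧ ∀ x, |deriv Real.smoothTransition x| ≤ A := by
  have hc : Continuous (deriv Real.smoothTransition) :=
    (Real.smoothTransition.contDiff (n := 1)).continuous_deriv (by norm_num)
  obtain ⟨A, hA⟩ := (isCompact_Icc (a := (0:ℝ)) (b := 1)).exists_bound_of_continuousOn
    hc.continuousOn
  refine ⟨max A 1, by positivity, fun x => ?_⟩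
  by_cases hx : x ∈ Set.Icc (0:ℝ) 1
  · exact (hA x hx).trans (le_max_left _ _)
  · have : deriv Real.smoothTransition x = 0 := by
      rw [Set.mem_Icc, not_and_or, not_le, not_le] at hx
      rcases hx with hx | hx
      · have : Real.smoothTransition =ᶠ[𝓝 x] fun _ => 0 := by
          filter_upwards [Iio_mem_nhds hx] with y hy
          exact Real.smoothTransition.zero_of_nonpos (le_of_lt hy)
        rw [this.deriv_eq]; simp
      · have : Real.smoothTransition =ᶠ[𝓝 x] fun _ => 1 := by
          filter_upwards [Ioi_mem_nhds hx] with y hy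
          exact Real.smoothTransition.one_of_one_le (le_of_lt hy)
        rw [this.deriv_eq]; simp
    rw [this]; simp

lemma aux_cutoff (p : ℝ) (hp : 1 < p) : ∃ A : ℝ, 0 < A ∧ ∀ (d : ℕ) (x0 : Ed d) (r R : ℝ),
    0 < r → r < R → ∃ θ : Ed d → ℝ, ContDiff ℝ (⊤ : ℕ∞) θ ∧ (∀ x, 0 ≤ θ x) ∧ (∀ x, θ x ≤ 1) ∧
      (∀ x ∈ Metric.closedBall x0 r, θ x = 1) ∧ (tsupport θ ⊆ Metric.closedBall x0 R) ∧
      ∀ x, ‖fderiv ℝ θ x‖ ^ p ≤ (A / (R - r)) ^ p * θ x ^ (p - 1) := by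
  obtain ⟨A, hA, hAb⟩ := aux_smoothTransition_bdd
  obtain ⟨m, hm⟩ := exists_nat_ge p
  have hm1 : (1:ℝ) < m := by linarith
  refine ⟨m * (2 * A), by positivity, fun d x0 r R hr hrR => ?_⟩
  have hRr : 0 < R ^ 2 - r ^ 2 := by nlinarith
  set q : Ed d → ℝ := fun x => (R ^ 2 - ‖x - x0‖ ^ 2) / (R ^ 2 - r ^ 2) with hq
  have hqs : ContDiff ℝ (⊤ : ℕ∞) q := by
    rw [hq]
    exact (contDiff_const.sub ((contDiff_id.sub contDiff_const).norm_sq ℝ)).div_const _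
  set η : Ed d → ℝ := fun x => Real.smoothTransition (q x) with hη
  have hηs : ContDiff ℝ (⊤ : ℕ∞) η := Real.smoothTransition.contDiff.comp hqs
  have hη0 : ∀ x, 0 ≤ η x := fun x => Real.smoothTransition.nonneg _
  have hη1 : ∀ x, η x ≤ 1 := fun x => Real.smoothTransition.le_one _
  have hηz : ∀ x, x ∉ Metric.closedBall x0 R → η x = 0 := by
    intro x hx
    apply Real.smoothTransition.zero_of_nonpos
    rw [Metric.mem_closedBall, not_le, dist_eq_norm] at hx
    apply div_nonpos_of_nonpos_of_nonneg _ hRr.le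
    nlinarith
  have hdq : ∀ x, HasFDerivAt q ((R ^ 2 - r ^ 2)⁻¹ • (-((2:ℕ) • (innerSL ℝ (x - x0) : Ed d →L[ℝ] ℝ)) : Ed d →L[ℝ] ℝ)) x := by
    intro x
    have h1 : HasFDerivAt (fun x : Ed d => ‖x - x0‖ ^ 2) ((2:ℕ) • (innerSL ℝ (x - x0) : Ed d →L[ℝ] ℝ)) x := by
      have := ((hasFDerivAt_id x).sub_const x0).norm_sq
      simpa using this
    have h2 := (h1.const_sub (R ^ 2)).const_smul ((R ^ 2 - r ^ 2)⁻¹)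
    refine h2.congr_of_eventuallyEq (Eventually.of_forall fun y => ?_)
    simp [hq, div_eq_inv_mul]
  have hdη : ∀ x, HasFDerivAt η (deriv Real.smoothTransition (q x) •
      ((R ^ 2 - r ^ 2)⁻¹ • (-((2:ℕ) • (innerSL ℝ (x - x0) : Ed d →L[ℝ] ℝ)) : Ed d →L[ℝ] ℝ))) x := by
    intro x
    have h1 : HasDerivAt Real.smoothTransition (deriv Real.smoothTransition (q x)) (q x) :=
      ((Real.smoothTransition.contDiff (n := 1)).differentiable (by norm_num) _).hasDerivAt
    exact h1.comp_hasFDerivAt x (hdq x)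
  have hηb : ∀ x, ‖fderiv ℝ η x‖ ≤ 2 * A / (R - r) := by
    intro x
    by_cases hx : x ∈ Metric.closedBall x0 R
    · rw [(hdη x).fderiv, norm_smul, norm_smul, norm_neg, Real.norm_eq_abs, Real.norm_eq_abs,
        abs_of_pos (inv_pos.2 hRr), two_smul]
      have h3 : ‖innerSL ℝ (x - x0) + innerSL ℝ (x - x0)‖ ≤ 2 * R := by
        refine (norm_add_le _ _).trans ?_
        rw [innerSL_apply_norm]
        rw [Metric.mem_closedBall, dist_eq_norm] at hx
        linarith
      calc _ ≤ A * ((R ^ 2 - r ^ 2)⁻¹ * (2 * R)) := by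
            gcongr
            exact hAb _
        _ ≤ _ := by
            rw [le_div_iff₀ (by linarith)]
            have : (R ^ 2 - r ^ 2)⁻¹ * (R - r) = (R + r)⁻¹ := by
              have h5 : R - r ≠ 0 := by linarith
              have h6 : R + r ≠ 0 := by linarith
              rw [show R ^ 2 - r ^ 2 = (R - r) * (R + r) by ring]
              field_simp
            calc A * ((R ^ 2 - r ^ 2)⁻¹ * (2 * R)) * (R - r)
                = 2 * A * (R * ((R ^ 2 - r ^ 2)⁻¹ * (R - r))) := by ring
              _ = 2 * A * (R * (R + r)⁻¹) := by rw [this]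
              _ ≤ 2 * A * 1 := by
                  gcongr
                  rw [← div_eq_mul_inv, div_le_one (by linarith)]
                  linarith
              _ = 2 * A := by ring
    · have : fderiv ℝ η x = 0 := by
        have : η =ᶠ[𝓝 x] fun _ => 0 := by
          filter_upwards [Metric.isClosed_closedBall.isOpen_compl.mem_nhds hx] with y hy
          exact hηz y hy
        rw [this.fderiv_eq]; simp
      rw [this, norm_zero]
      have : 0 < R - r := by linarith
      positivity
  refine ⟨fun x => η x ^ m, hηs.pow m, fun x => pow_nonneg (hη0 x) _,
    fun x => pow_le_one₀ (hη0 x) (hη1 x), ?_, ?_, ?_⟩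
  · intro x hx
    have : η x = 1 := by
      apply Real.smoothTransition.one_of_one_le
      rw [Metric.mem_closedBall, dist_eq_norm] at hx
      rw [le_div_iff₀ hRr]
      nlinarith [norm_nonneg (x - x0)]
    simp [this]
  · apply closure_minimal _ Metric.isClosed_closedBall
    intro x hx
    by_contra h
    apply hx
    have hm0 : m ≠ 0 := by rintro rfl; norm_num at hm1
    simp [hηz x h, hm0]
  · intro x
    have hd : HasFDerivAt (fun x => η x ^ m) ((m * η x ^ (m - 1)) • fderiv ℝ η x) x := by
      have := ((hηs.differentiable (by simp)) x).hasFDerivAt.pow m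
      rw [nsmul_eq_mul] at this
      exact this
    rw [hd.fderiv, norm_smul, Real.norm_eq_abs, abs_of_nonneg (by have := hη0 x; positivity)]
    have hRr' : 0 < R - r := by linarith
    have e1 : η x ^ (m - 1) = η x ^ ((m:ℝ) - 1) := by
      rw [← Real.rpow_natCast, Nat.cast_sub (by exact_mod_cast hm1.le)]; simp
    have e2 : (η x ^ m) ^ (p - 1) = η x ^ ((m:ℝ) * (p - 1)) := by
      rw [← Real.rpow_natCast, ← Real.rpow_mul (hη0 x)]
    have e3 : (η x ^ ((m:ℝ) - 1)) ^ p = η x ^ (((m:ℝ) - 1) * p) := by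
      rw [← Real.rpow_mul (hη0 x)]
    have hnn : 0 ≤ η x ^ ((m:ℝ) - 1) := Real.rpow_nonneg (hη0 x) _
    calc (m * η x ^ (m - 1) * ‖fderiv ℝ η x‖) ^ p
        ≤ (m * η x ^ ((m:ℝ) - 1) * (2 * A / (R - r))) ^ p := by
          rw [e1]
          have := hηb x
          gcongr
      _ = (m * (2 * A) / (R - r)) ^ p * η x ^ (((m:ℝ) - 1) * p) := by
          rw [← e3, ← Real.mul_rpow (by positivity) hnn]
          congr 1; ring
      _ ≤ _ := by
          rw [e2]
          refine mul_le_mul_of_nonneg_left ?_ (by positivity)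
          rcases (hη0 x).eq_or_lt with h | h
          · rw [← h, Real.zero_rpow (by nlinarith), Real.zero_rpow (by nlinarith)]
          · exact Real.rpow_le_rpow_of_exponent_ge h (hη1 x) (by nlinarith)

lemma aux_grad {d : ℕ} (u : Ed d → ℝ) (x : Ed d) : ‖gradient u x‖ = ‖fderiv ℝ u x‖ := by
  rw [gradient]; exact LinearIsometryEquiv.norm_map _ _

lemma aux_intV {d : ℕ} {Ω : Set (Ed d)} {V : Ed d → ℝ} (hV : LocBddOn Ω V) (f : Ed d → ℝ)
    (hf : Continuous f) (K : Set (Ed d)) (hK : IsCompact K) (hKΩ : K ⊆ Ω)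
    (h0 : ∀ x, x ∉ K → f x = 0) : Integrable (fun x => V x * f x) := by
  obtain ⟨M, hM⟩ := hV.2 K hK hKΩ
  have hfi : Integrable f := hf.integrable_of_hasCompactSupport (HasCompactSupport.intro hK h0)
  refine Integrable.mono' (hfi.norm.const_mul |M|)
    ((hV.1.mul hf.measurable).aestronglyMeasurable) ?_
  filter_upwards [hM] with x hx
  rw [norm_mul]
  by_cases hxK : x ∈ K
  · gcongr
    exact (hx hxK).trans (le_abs_self _)
  · simp [h0 x hxK]

lemma aux_test_facts {d : ℕ} {Ω : Set (Ed d)} {p : ℝ} (hp : 1 < p) {u : Ed d → ℝ}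
    (hu : IsTestOn Ω u) : Continuous (fun x => ‖fderiv ℝ u x‖ ^ p) ∧
      Continuous (fun x => |u x| ^ p) ∧ Integrable (fun x => ‖fderiv ℝ u x‖ ^ p) ∧
      Integrable (fun x => |u x| ^ p) ∧ (∀ x, x ∉ tsupport u → u x = 0 ∧ fderiv ℝ u x = 0) := by
  have hp0 : p ≠ 0 := by linarith
  have h1 : Continuous (fun x => ‖fderiv ℝ u x‖ ^ p) :=
    (hu.1.continuous_fderiv (by simp)).norm.rpow_const (fun _ => Or.inr (by linarith))
  have h2 : Continuous (fun x => |u x| ^ p) :=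
    hu.1.continuous.abs.rpow_const (fun _ => Or.inr (by linarith))
  have h3 : ∀ x, x ∉ tsupport u → u x = 0 ∧ fderiv ℝ u x = 0 := by
    intro x hx
    refine ⟨image_eq_zero_of_notMem_tsupport hx, ?_⟩
    have := tsupport_fderiv_subset ℝ (f := u)
    exact image_eq_zero_of_notMem_tsupport (fun h => hx (this h))
  refine ⟨h1, h2, ?_, ?_, h3⟩
  · exact h1.integrable_of_hasCompactSupport (HasCompactSupport.intro hu.2.1
      (fun x hx => by simp [(h3 x hx).2, hp0]))
  · exact h2.integrable_of_hasCompactSupport (HasCompactSupport.intro hu.2.1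
      (fun x hx => by simp [(h3 x hx).1, hp0]))

lemma aux_Q {d : ℕ} {Ω : Set (Ed d)} {p : ℝ} (hp : 1 < p) {V : Ed d → ℝ} {u : Ed d → ℝ}
    (hu : IsTestOn Ω u) :
    Qp p Ω V u = ∫ x, (‖fderiv ℝ u x‖ ^ p + V x * |u x| ^ p) := by
  have hp0 : p ≠ 0 := by linarith
  obtain ⟨_, _, _, _, h3⟩ := aux_test_facts hp hu
  unfold Qp
  simp_rw [aux_grad]
  apply setIntegral_eq_integral_of_forall_compl_eq_zero
  intro x hx
  have := h3 x (fun h => hx (hu.2.2 h))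
  simp [this.1, this.2, hp0]

lemma aux_QI {d : ℕ} {Ω : Set (Ed d)} {p : ℝ} (hp : 1 < p) {V : Ed d → ℝ} {u : Ed d → ℝ}
    (hV : LocBddOn Ω V) (hu : IsTestOn Ω u) :
    Integrable (fun x => V x * |u x| ^ p) := by
  obtain ⟨h1, h2, h3, h4, h5⟩ := aux_test_facts hp hu
  exact aux_intV hV _ h2 _ hu.2.1 hu.2.2
    (fun x hx => by simp [(h5 x hx).1, (by linarith : p ≠ 0)])

lemma aux_cacc (p : ℝ) (hp : 1 < p) : ∃ A : ℝ, 0 < A ∧ ∀ (d : ℕ) (Ω : Set (Ed d)) (V u : Ed d → ℝ)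
    (x0 : Ed d) (r R M : ℝ), LocBddOn Ω V → NonnegOn p Ω V → IsTestOn Ω u → 0 < r → r < R →
    0 ≤ M → (∀ᵐ x ∂(volume : Measure (Ed d)), x ∈ Metric.closedBall x0 R → |V x| ≤ M) →
    ∫ x in Metric.ball x0 r, ‖fderiv ℝ u x‖ ^ p ≤
      Qp p Ω V u + ((A / (R - r)) ^ p + M) * ∫ x in Metric.closedBall x0 R, |u x| ^ p := by
  obtain ⟨A, hA, hcut⟩ := aux_cutoff p hp
  refine ⟨A, hA, fun d Ω V u x0 r R M hV hnn hu hr hrR hM hVM => ?_⟩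
  obtain ⟨θ, hθs, hθ0, hθ1, hθr, hθR, hθd⟩ := hcut d x0 r R hr hrR
  have hp0 : p ≠ 0 := by linarith
  have hRr : 0 < R - r := by linarith
  set v : Ed d → ℝ := fun x => (1 - θ x) * u x with hv
  have hvt : IsTestOn Ω v := by
    refine ⟨(contDiff_const.sub hθs).mul hu.1, hu.2.1.mul_left, ?_⟩
    refine subset_trans ?_ hu.2.2
    exact tsupport_mul_subset_right (f := fun x => 1 - θ x)
  have h0 := hnn v hvt
  obtain ⟨hc1, hc2, hi1, hi2, hz⟩ := aux_test_facts hp hu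
  obtain ⟨_, _, hi1', _, _⟩ := aux_test_facts hp hvt
  rw [aux_Q hp hvt] at h0
  rw [aux_Q hp hu]
  have hB : MeasurableSet (Metric.ball x0 r) := Metric.isOpen_ball.measurableSet
  have hC : MeasurableSet (Metric.closedBall x0 R) := Metric.isClosed_closedBall.measurableSet
  set c := (A / (R - r)) ^ p + M with hc
  have hle : ∫ x, (‖fderiv ℝ v x‖ ^ p + V x * |v x| ^ p) ≤
      ∫ x, ((‖fderiv ℝ u x‖ ^ p + V x * |u x| ^ p) -
        (Metric.ball x0 r).indicator (fun x => ‖fderiv ℝ u x‖ ^ p) x +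
        c * (Metric.closedBall x0 R).indicator (fun x => |u x| ^ p) x) := by
    apply integral_mono_ae (hi1'.add (aux_QI hp hV hvt))
      (((hi1.add (aux_QI hp hV hu)).sub (hi1.indicator hB)).add ((hi2.indicator hC).const_mul _))
    filter_upwards [hVM] with x hx
    simp only [Pi.add_apply, Pi.sub_apply]
    have hdv : fderiv ℝ v x = (1 - θ x) • fderiv ℝ u x - u x • fderiv ℝ θ x := by
      have h1 := (hθs.differentiable (by simp) x).hasFDerivAt
      have h2 := (hu.1.differentiable (by simp) x).hasFDerivAt
      have this : fderiv ℝ v x = _ := ((h1.const_sub 1).mul h2).fderiv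
      rw [this, smul_neg, ← sub_eq_add_neg]
    have hnv : ‖fderiv ℝ v x‖ ≤ (1 - θ x) * ‖fderiv ℝ u x‖ + |u x| * ‖fderiv ℝ θ x‖ := by
      rw [hdv]
      refine (norm_sub_le _ _).trans ?_
      rw [norm_smul, norm_smul, Real.norm_eq_abs, Real.norm_eq_abs,
        abs_of_nonneg (by linarith [hθ1 x])]
    have hup : 0 ≤ |u x| ^ p := by positivity
    have hgrad : ‖fderiv ℝ v x‖ ^ p ≤ (1 - θ x) * ‖fderiv ℝ u x‖ ^ p +
        |u x| ^ p * (A / (R - r)) ^ p := by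
      refine le_trans (Real.rpow_le_rpow (norm_nonneg _) hnv (by linarith)) ?_
      apply aux_real hp (hθ0 x) (hθ1 x) (norm_nonneg _) (by positivity) (by positivity)
      rw [Real.mul_rpow (abs_nonneg _) (norm_nonneg _), mul_assoc]
      exact mul_le_mul_of_nonneg_left (hθd x) hup
    by_cases hxR : x ∈ Metric.closedBall x0 R
    · rw [Set.indicator_of_mem hxR]
      have hVx := hx hxR
      have h1 : (Metric.ball x0 r).indicator (fun x => ‖fderiv ℝ u x‖ ^ p) x ≤
          θ x * ‖fderiv ℝ u x‖ ^ p := by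
        by_cases hxr : x ∈ Metric.ball x0 r
        · rw [Set.indicator_of_mem hxr, hθr x (Metric.ball_subset_closedBall hxr), one_mul]
        · rw [Set.indicator_of_notMem hxr]
          have := hθ0 x
          positivity
      have h2 : V x * |v x| ^ p ≤ V x * |u x| ^ p + M * |u x| ^ p := by
        have e : |v x| ^ p = (1 - θ x) ^ p * |u x| ^ p := by
          rw [hv, abs_mul, abs_of_nonneg (by linarith [hθ1 x] : 0 ≤ 1 - θ x),
            Real.mul_rpow (by linarith [hθ1 x]) (abs_nonneg _)]
        rw [e]
        have k1 : (1 - θ x) ^ p ≤ 1 :=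
          Real.rpow_le_one (by linarith [hθ1 x]) (by linarith [hθ0 x]) (by linarith)
        have k0 : 0 ≤ (1 - θ x) ^ p := Real.rpow_nonneg (by linarith [hθ1 x]) _
        have k2 : V x * ((1 - θ x) ^ p - 1) ≤ M := by
          have := abs_le.1 hVx
          nlinarith
        nlinarith
      rw [hc]
      nlinarith
    · have hxr : x ∉ Metric.ball x0 r := fun h => hxR
        (Metric.closedBall_subset_closedBall hrR.le (Metric.ball_subset_closedBall h))
      rw [Set.indicator_of_notMem hxR, Set.indicator_of_notMem hxr]
      have ht : θ x = 0 := image_eq_zero_of_notMem_tsupport (fun h => hxR (hθR h))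
      have htd : fderiv ℝ θ x = 0 := image_eq_zero_of_notMem_tsupport
        (fun h => hxR (hθR (tsupport_fderiv_subset ℝ h)))
      have hvx : v x = u x := by simp [hv, ht]
      rw [hdv, hvx, ht, htd]
      simp
  have hqi : Integrable (fun x => ‖fderiv ℝ u x‖ ^ p + V x * |u x| ^ p) :=
    hi1.add (aux_QI hp hV hu)
  have hI : ∫ x, ((‖fderiv ℝ u x‖ ^ p + V x * |u x| ^ p) -
        (Metric.ball x0 r).indicator (fun x => ‖fderiv ℝ u x‖ ^ p) x +
        c * (Metric.closedBall x0 R).indicator (fun x => |u x| ^ p) x) =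
      (∫ x, (‖fderiv ℝ u x‖ ^ p + V x * |u x| ^ p)) - (∫ x in Metric.ball x0 r, ‖fderiv ℝ u x‖ ^ p)
       + c * ∫ x in Metric.closedBall x0 R, |u x| ^ p := by
    rw [← integral_indicator hB, ← integral_indicator hC, ← integral_const_mul,
      ← integral_sub hqi (hi1.indicator hB)]
    exact integral_add (hqi.sub (hi1.indicator hB)) ((hi2.indicator hC).const_mul _)
  linarith

lemma aux_logreal {p U X s t a b C : ℝ} (hp : 1 < p) (hU : 0 < U) (hs : 0 < s) (ht : 0 ≤ t)
    (hX : X = U ^ p + s * t) (ha : 0 ≤ a) (hb : 0 ≤ b) (hC : 0 ≤ C)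
    (h : b ^ p ≤ C * t ^ (p - 1)) :
    (X ^ (1 / p - 1) * (U ^ (p - 1) * a + s / p * b)) ^ p ≤ a ^ p + s * C := by
  have hp0 : 0 < p := by linarith
  have hUp : 0 < U ^ p := Real.rpow_pos_of_pos hU _
  have hX0 : 0 < X := by rw [hX]; positivity
  have hτ0 : 0 ≤ s * t / X := by positivity
  have hτ : 1 - s * t / X = U ^ p / X := by
    rw [eq_div_iff hX0.ne', sub_mul, div_mul_cancel₀ _ hX0.ne', hX]; ring
  have hτ1 : s * t / X ≤ 1 := by
    have : 0 < U ^ p / X := by positivity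
    linarith
  have hXp : (X ^ (1 / p)) ^ p = X := by
    rw [← Real.rpow_mul hX0.le, one_div, inv_mul_cancel₀ hp0.ne', Real.rpow_one]
  have key := aux_real (p := p) (τ := s * t / X) (a := a * (X ^ (1 / p) / U))
    (b := X ^ (1 / p - 1) * (s / p * b)) (C := s * C) hp hτ0 hτ1 (by positivity) (by positivity)
    (by positivity) (by
      have hq : (X ^ (1 / p - 1)) ^ p = X ^ (1 - p) := by
        rw [← Real.rpow_mul hX0.le]; congr 1; field_simp
      rw [Real.mul_rpow (by positivity) (by positivity), Real.mul_rpow (by positivity) hb, hq]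
      have h1 : (s / p) ^ p ≤ s ^ p := by
        apply Real.rpow_le_rpow (by positivity) (div_le_self hs.le hp.le) hp0.le
      have h2 : X ^ (1 - p) = (X ^ (p - 1))⁻¹ := by
        rw [← Real.rpow_neg hX0.le]; congr 1; ring
      calc X ^ (1 - p) * ((s / p) ^ p * b ^ p)
          ≤ X ^ (1 - p) * (s ^ p * (C * t ^ (p - 1))) := by gcongr
        _ = s * C * (s * t / X) ^ (p - 1) := by
            rw [Real.div_rpow (by positivity) hX0.le, Real.mul_rpow hs.le ht, h2,
              show s ^ p = s ^ (p - 1) * s by rw [← Real.rpow_add_one hs.ne']; ring_nf]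
            field_simp)
  rw [hτ] at key
  have e1 : U ^ p / X * (a * (X ^ (1 / p) / U)) = X ^ (1 / p - 1) * (U ^ (p - 1) * a) := by
    rw [Real.rpow_sub_one hX0.ne', Real.rpow_sub_one hU.ne']; ring
  have e2 : U ^ p / X * (a * (X ^ (1 / p) / U)) ^ p = a ^ p := by
    rw [Real.mul_rpow ha (by positivity), Real.div_rpow (by positivity) hU.le, hXp]
    field_simp
  rw [e1, e2, ← mul_add] at key
  exact key

lemma aux_logreal2 {p U s a : ℝ} (hp : 1 < p) (hU : 0 < U) (hs : 0 < s) (ha : 0 ≤ a) :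
    ((U ^ p + s) ^ (1 / p - 1) * (U ^ (p - 1) * a)) ^ p = (U ^ p / (U ^ p + s)) ^ (p - 1) * a ^ p := by
  have hp0 : 0 < p := by linarith
  have hUp : 0 < U ^ p := Real.rpow_pos_of_pos hU _
  have hX0 : 0 < U ^ p + s := by positivity
  rw [Real.mul_rpow (by positivity) (by positivity), Real.mul_rpow (by positivity) ha,
    Real.div_rpow hUp.le hX0.le, ← Real.rpow_mul hX0.le, ← Real.rpow_mul hU.le,
    ← Real.rpow_mul hU.le, show (1 / p - 1) * p = -(p - 1) by field_simp; ring,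
    Real.rpow_neg hX0.le, mul_comm (p - 1) p]
  field_simp

def auxU {d : ℕ} (u : Ed d → ℝ) (δ : ℝ) (x : Ed d) : ℝ := Real.sqrt (u x ^ 2 + δ ^ 2)

def auxv {d : ℕ} (p s : ℝ) (u θ : Ed d → ℝ) (δ : ℝ) (x : Ed d) : ℝ :=
  (auxU u δ x ^ p + s * θ x) ^ (1 / p) - δ

lemma auxU_ge {d : ℕ} (u : Ed d → ℝ) {δ : ℝ} (hδ : 0 < δ) (x : Ed d) :
    δ ≤ auxU u δ x ∧ |u x| ≤ auxU u δ x := by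
  constructor
  · exact Real.le_sqrt_of_sq_le (by nlinarith [sq_nonneg (u x)])
  · exact Real.abs_le_sqrt (by nlinarith [sq_nonneg δ])

lemma auxU_deriv {d : ℕ} {u : Ed d → ℝ} (hu : ContDiff ℝ (⊤ : ℕ∞) u) {δ : ℝ} (hδ : 0 < δ) (x : Ed d) :
    ∃ L : Ed d →L[ℝ] ℝ, HasFDerivAt (auxU u δ) L x ∧ ‖L‖ ≤ ‖fderiv ℝ u x‖ := by
  have h2 := (hu.differentiable (by simp) x).hasFDerivAt
  have hU := auxU_ge u hδ x
  have hne : u x ^ 2 + δ ^ 2 ≠ 0 := by positivity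
  have h3 := ((h2.pow 2).add_const (δ ^ 2)).sqrt hne
  refine ⟨_, h3, ?_⟩
  have hU0 : 0 < auxU u δ x := lt_of_lt_of_le hδ hU.1
  change ‖(1 / (2 * auxU u δ x)) • _‖ ≤ _
  rw [norm_smul]
  simp only [Nat.add_one_sub_one, pow_one]
  rw [norm_smul, ← mul_assoc]
  refine mul_le_of_le_one_left (norm_nonneg _) ?_
  simp only [Real.norm_eq_abs, nsmul_eq_mul, abs_mul, abs_div, abs_one, abs_of_pos hU0]
  norm_num
  rw [inv_mul_eq_div]
  rw [div_mul_eq_mul_div, ← mul_assoc]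
  rw [div_le_one hU0]
  linarith [hU.2]

lemma auxv_test {d : ℕ} {Ω : Set (Ed d)} {p s R : ℝ} {u θ : Ed d → ℝ} {x0 : Ed d} (hp : 1 < p)
    (hs : 0 < s) (hu : IsTestOn Ω u) (hθs : ContDiff ℝ (⊤ : ℕ∞) θ) (hθ0 : ∀ x, 0 ≤ θ x)
    (hθR : tsupport θ ⊆ Metric.closedBall x0 R) (hRΩ : Metric.closedBall x0 R ⊆ Ω)
    {δ : ℝ} (hδ : 0 < δ) : IsTestOn Ω (auxv p s u θ δ) ∧
      (∀ x, x ∉ tsupport u ∪ Metric.closedBall x0 R → auxv p s u θ δ x = 0) := by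
  have hp0 : 0 < p := by linarith
  have hU0 : ∀ x, 0 < auxU u δ x := fun x => lt_of_lt_of_le hδ (auxU_ge u hδ x).1
  have hUs : ContDiff ℝ (⊤ : ℕ∞) (auxU u δ) := by
    apply ContDiff.sqrt
    · exact (hu.1.pow 2).add contDiff_const
    · intro x; positivity
  have hz : ∀ x, x ∉ tsupport u ∪ Metric.closedBall x0 R → auxv p s u θ δ x = 0 := by
    intro x hx
    have h1 : u x = 0 := image_eq_zero_of_notMem_tsupport (fun h => hx (Or.inl h))
    have h2 : θ x = 0 := image_eq_zero_of_notMem_tsupport (fun h => hx (Or.inr (hθR h)))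
    simp only [auxv, auxU, h1, h2]
    have : √(0 ^ 2 + δ ^ 2) = δ := by
      rw [show (0:ℝ) ^ 2 + δ ^ 2 = δ ^ 2 by ring, Real.sqrt_sq hδ.le]
    rw [this, mul_zero, add_zero, ← Real.rpow_mul hδ.le, mul_one_div_cancel hp0.ne', Real.rpow_one,
      sub_self]
  have hK : IsCompact (tsupport u ∪ Metric.closedBall x0 R) :=
    IsCompact.union hu.2.1 (isCompact_closedBall _ _)
  refine ⟨⟨?_, HasCompactSupport.intro hK hz, ?_⟩, hz⟩
  · refine ContDiff.sub (ContDiff.rpow_const_of_ne ?_ ?_) contDiff_const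
    · exact (hUs.rpow_const_of_ne (fun x => (hU0 x).ne')).add (contDiff_const.mul hθs)
    · intro x
      have := Real.rpow_pos_of_pos (hU0 x) p
      have := hθ0 x
      positivity
  · refine subset_trans (closure_minimal ?_ hK.isClosed) (Set.union_subset hu.2.2 hRΩ)
    intro x hx
    by_contra h
    exact hx (hz x h)

lemma auxv_grad {d : ℕ} {Ω : Set (Ed d)} {p s r R B : ℝ} {u θ : Ed d → ℝ} {x0 : Ed d} (hp : 1 < p)
    (hs : 0 < s) (hrR : r < R) (hB : 0 ≤ B)
    (hu : IsTestOn Ω u) (hθs : ContDiff ℝ (⊤ : ℕ∞) θ) (hθ0 : ∀ x, 0 ≤ θ x)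
    (hθr : ∀ x ∈ Metric.closedBall x0 r, θ x = 1)
    (hθR : tsupport θ ⊆ Metric.closedBall x0 R)
    (hθd : ∀ x, ‖fderiv ℝ θ x‖ ^ p ≤ B * θ x ^ (p - 1))
    {δ : ℝ} (hδ : 0 < δ) (x : Ed d) : ‖fderiv ℝ (auxv p s u θ δ) x‖ ^ p ≤
      ‖fderiv ℝ u x‖ ^ p + s * (Metric.closedBall x0 R).indicator (fun _ => B) x -
      (Metric.ball x0 r).indicator (fun x =>
        (1 - (auxU u δ x ^ p / (auxU u δ x ^ p + s)) ^ (p - 1)) * ‖fderiv ℝ u x‖ ^ p) x := by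
  have hp0 : 0 < p := by linarith
  have hU0 : 0 < auxU u δ x := lt_of_lt_of_le hδ (auxU_ge u hδ x).1
  have hUp := Real.rpow_pos_of_pos hU0 p
  obtain ⟨L, hL, hLn⟩ := auxU_deriv hu.1 hδ x
  have ht := (hθs.differentiable (by simp) x).hasFDerivAt
  have hθx := hθ0 x
  have hX0 : 0 < auxU u δ x ^ p + s * θ x := by positivity
  have hD := (((hL.rpow_const (p := p) (Or.inl hU0.ne')).add (ht.const_smul s)).rpow_const
    (p := 1 / p) (Or.inl hX0.ne')).sub_const δ
  have hD' : fderiv ℝ (auxv p s u θ δ) x = _ := hD.fderiv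
  have hn : ‖fderiv ℝ (auxv p s u θ δ) x‖ ≤ (auxU u δ x ^ p + s * θ x) ^ (1 / p - 1) *
      (auxU u δ x ^ (p - 1) * ‖L‖ + s / p * ‖fderiv ℝ θ x‖) := by
    rw [hD', norm_smul]
    have : ‖(p * auxU u δ x ^ (p - 1)) • L + s • fderiv ℝ θ x‖ ≤
        p * auxU u δ x ^ (p - 1) * ‖L‖ + s * ‖fderiv ℝ θ x‖ := by
      refine (norm_add_le _ _).trans ?_
      rw [norm_smul, norm_smul, Real.norm_of_nonneg (by positivity), Real.norm_of_nonneg hs.le]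
    rw [Real.norm_of_nonneg (by simp only [Pi.add_apply, Pi.smul_apply, smul_eq_mul]; positivity)]
    simp only [Pi.add_apply, Pi.smul_apply, smul_eq_mul]
    calc _ ≤ 1 / p * (auxU u δ x ^ p + s * θ x) ^ (1 / p - 1) *
          (p * auxU u δ x ^ (p - 1) * ‖L‖ + s * ‖fderiv ℝ θ x‖) := by gcongr
      _ = _ := by field_simp
  have hLp : ‖L‖ ^ p ≤ ‖fderiv ℝ u x‖ ^ p := Real.rpow_le_rpow (norm_nonneg _) hLn hp0.le
  have hnp := Real.rpow_le_rpow (norm_nonneg _) hn hp0.le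
  by_cases hxR : x ∈ Metric.closedBall x0 R
  · rw [Set.indicator_of_mem hxR]
    by_cases hxr : x ∈ Metric.ball x0 r
    · rw [Set.indicator_of_mem hxr]
      have h1 : θ x = 1 := hθr x (Metric.ball_subset_closedBall hxr)
      have h2 : fderiv ℝ θ x = 0 := by
        have : θ =ᶠ[𝓝 x] fun _ => 1 := by
          filter_upwards [Metric.isOpen_ball.mem_nhds hxr] with y hy
          exact hθr y (Metric.ball_subset_closedBall hy)
        rw [this.fderiv_eq]; simp
      rw [h1, h2, norm_zero, mul_zero, add_zero, mul_one, aux_logreal2 hp hU0 hs (norm_nonneg _)] at hnp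
      have h3 : 0 ≤ (auxU u δ x ^ p / (auxU u δ x ^ p + s)) ^ (p - 1) := by positivity
      have := mul_le_mul_of_nonneg_left hLp h3
      have : 0 ≤ s * B := by positivity
      linarith
    · rw [Set.indicator_of_notMem hxr, sub_zero]
      have := aux_logreal hp hU0 hs hθx rfl (norm_nonneg L) (norm_nonneg _) hB (hθd x)
      linarith
  · have hxr : x ∉ Metric.ball x0 r := fun h => hxR
        (Metric.closedBall_subset_closedBall hrR.le (Metric.ball_subset_closedBall h))
    rw [Set.indicator_of_notMem hxR, Set.indicator_of_notMem hxr]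
    have htd : fderiv ℝ θ x = 0 := image_eq_zero_of_notMem_tsupport
        (fun h => hxR (hθR (tsupport_fderiv_subset ℝ h)))
    have := aux_logreal hp hU0 hs hθx rfl (norm_nonneg L) (norm_nonneg (fderiv ℝ θ x)) (le_refl 0)
      (by rw [htd, norm_zero, Real.zero_rpow hp0.ne', zero_mul])
    linarith

lemma auxv_bd {p s δ U t : ℝ} (hp : 1 < p) (hs : 0 < s) (hδ : 0 < δ) (hU : δ ≤ U) (ht : 0 ≤ t) :
    |(U ^ p + s * t) ^ (1 / p) - δ| ^ p ≤ U ^ p + s * t := by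
  have hp0 : 0 < p := by linarith
  have hU0 : 0 < U := by linarith
  have h1 : δ ≤ (U ^ p + s * t) ^ (1 / p) := by
    calc δ ≤ U := hU
      _ = (U ^ p) ^ (1 / p) := by
        rw [← Real.rpow_mul hU0.le, mul_one_div_cancel hp0.ne', Real.rpow_one]
      _ ≤ _ := by
        apply Real.rpow_le_rpow (by positivity) _ (by positivity)
        have : 0 ≤ s * t := by positivity
        linarith
  rw [abs_of_nonneg (by linarith)]
  calc _ ≤ ((U ^ p + s * t) ^ (1 / p)) ^ p :=
        Real.rpow_le_rpow (by linarith) (by linarith) hp0.le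
    _ = _ := by
      rw [← Real.rpow_mul (by positivity), one_div_mul_cancel hp0.ne', Real.rpow_one]

lemma auxU_cont {d : ℕ} (u : Ed d → ℝ) (hu : Continuous u) (δ : ℝ) : Continuous (auxU u δ) := by
  unfold auxU; fun_prop

lemma auxU_tendsto {d : ℕ} (u : Ed d → ℝ) (x : Ed d) :
    Tendsto (fun n : ℕ => auxU u (1 / ((n : ℝ) + 1)) x) atTop (𝓝 |u x|) := by
  have h := tendsto_one_div_add_atTop_nhds_zero_nat (𝕜 := ℝ)
  have := ((h.pow 2).const_add (u x ^ 2)).sqrt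
  simpa [auxU, Real.sqrt_sq_eq_abs] using this

lemma aux_log (p : ℝ) (hp : 1 < p) : ∃ A : ℝ, 0 < A ∧ ∀ (d : ℕ) (Ω : Set (Ed d)) (V u : Ed d → ℝ)
    (x0 : Ed d) (r R M s : ℝ), LocBddOn Ω V → NonnegOn p Ω V → IsTestOn Ω u → 0 < r → r < R →
    Metric.closedBall x0 R ⊆ Ω → 0 < s →
    0 ≤ M → (∀ᵐ x ∂(volume : Measure (Ed d)), x ∈ Metric.closedBall x0 R → |V x| ≤ M) →
    ∫ x in Metric.ball x0 r, (1 - (|u x| ^ p / (|u x| ^ p + s)) ^ (p - 1)) * ‖fderiv ℝ u x‖ ^ p ≤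
      Qp p Ω V u + s * ((A / (R - r)) ^ p + M) * volume.real (Metric.closedBall x0 R) := by
  obtain ⟨A, hA, hcut⟩ := aux_cutoff p hp
  refine ⟨A, hA, fun d Ω V u x0 r R M s hV hnn hu hr hrR hRΩ hs hM hVM => ?_⟩
  obtain ⟨θ, hθs, hθ0, hθ1, hθr, hθR, hθd⟩ := hcut d x0 r R hr hrR
  have hp0 : 0 < p := by linarith
  have hRr : 0 < R - r := by linarith
  set B := (A / (R - r)) ^ p with hBdef
  have hB0 : 0 ≤ B := by positivity
  set δ : ℕ → ℝ := fun n => 1 / ((n : ℝ) + 1) with hδdef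
  have hδ : ∀ n, 0 < δ n := fun n => by simp only [hδdef]; positivity
  have hδ1 : ∀ n, δ n ≤ 1 := fun n => by
    simp only [hδdef]; rw [div_le_one (by positivity)]; linarith [(Nat.cast_nonneg n : (0:ℝ) ≤ n)]
  have hδ0 : Tendsto δ atTop (𝓝 0) := tendsto_one_div_add_atTop_nhds_zero_nat
  obtain ⟨hc1, hc2, hi1, hi2, hz⟩ := aux_test_facts hp hu
  have hBm : MeasurableSet (Metric.ball x0 r) := Metric.isOpen_ball.measurableSet
  have hCm : MeasurableSet (Metric.closedBall x0 R) := Metric.isClosed_closedBall.measurableSet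
  have hCfin : volume (Metric.closedBall x0 R) ≠ ⊤ := (isCompact_closedBall _ _).measure_lt_top.ne
  have hθz : ∀ x, x ∉ Metric.closedBall x0 R → θ x = 0 := fun x hx =>
    image_eq_zero_of_notMem_tsupport (fun h => hx (hθR h))
  set K := tsupport u ∪ Metric.closedBall x0 R with hKdef
  have hK : IsCompact K := IsCompact.union hu.2.1 (isCompact_closedBall _ _)
  have hKΩ : K ⊆ Ω := Set.union_subset hu.2.2 hRΩ
  obtain ⟨MK, hMK⟩ := hV.2 K hK hKΩ
  obtain ⟨Cu, hCu⟩ := hu.2.1.exists_bound_of_continuous hu.1.continuous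
  -- the gradient part
  set F : ℕ → Ed d → ℝ := fun n => (Metric.ball x0 r).indicator (fun x =>
        (1 - (auxU u (δ n) x ^ p / (auxU u (δ n) x ^ p + s)) ^ (p - 1)) * ‖fderiv ℝ u x‖ ^ p) with hF
  have hlam : ∀ U : ℝ, 0 ≤ U → 0 ≤ (U ^ p / (U ^ p + s)) ^ (p - 1) ∧
      (U ^ p / (U ^ p + s)) ^ (p - 1) ≤ 1 := by
    intro U hU
    have h1 : 0 ≤ U ^ p := Real.rpow_nonneg hU _
    refine ⟨by positivity, Real.rpow_le_one (by positivity) ?_ (by linarith)⟩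
    rw [div_le_one (by positivity)]; linarith
  have hFmeas : ∀ n, AEStronglyMeasurable (F n) volume := by
    intro n
    have h1 : Continuous (auxU u (δ n)) := auxU_cont u hu.1.continuous _
    have h2 : Measurable (fun x =>
        (1 - (auxU u (δ n) x ^ p / (auxU u (δ n) x ^ p + s)) ^ (p - 1)) * ‖fderiv ℝ u x‖ ^ p) := by
      have := h1.measurable
      have := hc1.measurable
      fun_prop
    exact (h2.indicator hBm).aestronglyMeasurable
  have hFb : ∀ n x, ‖F n x‖ ≤ ‖fderiv ℝ u x‖ ^ p := by
    intro n x
    refine (norm_indicator_le_norm_self _ _).trans ?_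
    have := hlam _ (Real.sqrt_nonneg (u x ^ 2 + δ n ^ 2))
    change 0 ≤ (auxU u (δ n) x ^ p / (auxU u (δ n) x ^ p + s)) ^ (p - 1) ∧
      (auxU u (δ n) x ^ p / (auxU u (δ n) x ^ p + s)) ^ (p - 1) ≤ 1 at this
    have hg : 0 ≤ ‖fderiv ℝ u x‖ ^ p := by positivity
    rw [norm_mul, Real.norm_of_nonneg hg, Real.norm_of_nonneg (by linarith)]
    nlinarith
  have hFint : ∀ n, Integrable (F n) := fun n =>
    hi1.mono' (hFmeas n) (Eventually.of_forall (hFb n))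
  have hFlim : Tendsto (fun n => ∫ x, F n x) atTop (𝓝 (∫ x, (Metric.ball x0 r).indicator (fun x =>
        (1 - (|u x| ^ p / (|u x| ^ p + s)) ^ (p - 1)) * ‖fderiv ℝ u x‖ ^ p) x)) := by
    refine tendsto_integral_of_dominated_convergence _ hFmeas hi1
      (fun n => Eventually.of_forall (hFb n)) (Eventually.of_forall fun x => ?_)
    by_cases hx : x ∈ Metric.ball x0 r
    · simp only [hF, Set.indicator_of_mem hx]
      have h1 := (auxU_tendsto u x).rpow_const (p := p) (Or.inr hp0.le)
      have hup : 0 ≤ |u x| ^ p := by positivity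
      have h2 := (h1.div (h1.add_const s) (by positivity)).rpow_const (p := p - 1)
        (Or.inr (by linarith))
      exact (h2.const_sub 1).mul_const _
    · simp only [hF, Set.indicator_of_notMem hx]
      exact tendsto_const_nhds
  -- the potential part
  set v : ℕ → Ed d → ℝ := fun n => auxv p s u θ (δ n) with hv
  have hvt : ∀ n, IsTestOn Ω (v n) := fun n => (auxv_test hp hs hu hθs hθ0 hθR hRΩ (hδ n)).1
  have hvz : ∀ n x, x ∉ K → v n x = 0 := fun n => (auxv_test hp hs hu hθs hθ0 hθR hRΩ (hδ n)).2
  set C1 := (Real.sqrt (Cu ^ 2 + 1)) ^ p + s with hC1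
  have hvb : ∀ n x, |v n x| ^ p ≤ C1 := by
    intro n x
    have h1 := auxv_bd hp hs (hδ n) (auxU_ge u (hδ n) x).1 (hθ0 x)
    have h2 : auxU u (δ n) x ≤ Real.sqrt (Cu ^ 2 + 1) := by
      apply Real.sqrt_le_sqrt
      have h3 := hCu x
      rw [Real.norm_eq_abs] at h3
      have h4 : u x ^ 2 ≤ Cu ^ 2 := by
        rw [← sq_abs (u x)]; exact pow_le_pow_left₀ (abs_nonneg _) h3 2
      have h5 : δ n ^ 2 ≤ 1 := pow_le_one₀ (hδ n).le (hδ1 n)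
      linarith
    have h3 : auxU u (δ n) x ^ p ≤ (Real.sqrt (Cu ^ 2 + 1)) ^ p :=
      Real.rpow_le_rpow (Real.sqrt_nonneg _) h2 hp0.le
    have h4 : s * θ x ≤ s := mul_le_of_le_one_right hs.le (hθ1 x)
    refine le_trans h1 ?_
    linarith
  have hvlim : Tendsto (fun n => ∫ x, V x * |v n x| ^ p) atTop
      (𝓝 (∫ x, V x * (|u x| ^ p + s * θ x))) := by
    refine tendsto_integral_of_dominated_convergence (K.indicator (fun _ => |MK| * C1))
      (fun n => ((aux_QI hp hV (hvt n))).aestronglyMeasurable)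
      ((integrable_indicator_iff hK.isClosed.measurableSet).2
        (integrableOn_const hK.measure_lt_top.ne)) (fun n => ?_) (Eventually.of_forall fun x => ?_)
    · filter_upwards [hMK] with x hx
      by_cases hxK : x ∈ K
      · rw [Set.indicator_of_mem hxK, norm_mul, Real.norm_of_nonneg (by positivity : 0 ≤ |v n x| ^ p)]
        have := hvb n x
        have h6 := (hx hxK).trans (le_abs_self _)
        rw [Real.norm_eq_abs]
        gcongr
      · rw [Set.indicator_of_notMem hxK, hvz n x hxK]
        simp [hp0.ne']
    · have h1 := (((((auxU_tendsto u x).rpow_const (p := p) (Or.inr hp0.le)).add_const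
        (s * θ x)).rpow_const (p := 1 / p) (Or.inr (by positivity))).sub hδ0).abs.rpow_const
        (p := p) (Or.inr hp0.le)
      have hup : 0 ≤ |u x| ^ p := by positivity
      have hX : 0 ≤ |u x| ^ p + s * θ x := by have := hθ0 x; positivity
      have h2 : |(|u x| ^ p + s * θ x) ^ (1 / p) - 0| ^ p = |u x| ^ p + s * θ x := by
        rw [sub_zero, abs_of_nonneg (by positivity), ← Real.rpow_mul hX, one_div_mul_cancel hp0.ne',
          Real.rpow_one]
      rw [h2] at h1
      exact h1.const_mul _
  have hVu := aux_QI hp hV hu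
  have hVθ : Integrable (fun x => V x * (s * θ x)) :=
    aux_intV hV _ (hθs.continuous.const_mul s |>.congr fun _ => rfl) _ (isCompact_closedBall x0 R) hRΩ
      (fun x hx => by rw [hθz x hx, mul_zero])
  have hJ : ∫ x, V x * (|u x| ^ p + s * θ x) ≤
      (∫ x, V x * |u x| ^ p) + s * M * volume.real (Metric.closedBall x0 R) := by
    have e : ∫ x, V x * (|u x| ^ p + s * θ x) = (∫ x, V x * |u x| ^ p) + ∫ x, V x * (s * θ x) := by
      rw [← integral_add hVu hVθ]; simp only [mul_add]
    rw [e]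
    gcongr
    have h1 : ∫ x, V x * (s * θ x) ≤ ∫ x, (Metric.closedBall x0 R).indicator (fun _ => s * M) x := by
      apply integral_mono_ae hVθ ((integrable_indicator_iff hCm).2 (integrableOn_const hCfin))
      filter_upwards [hVM] with x hx
      by_cases hxR : x ∈ Metric.closedBall x0 R
      · rw [Set.indicator_of_mem hxR]
        have h3 := (le_abs_self _).trans (hx hxR)
        have h4 : V x * θ x ≤ M := by
          have := hθ0 x
          have := hθ1 x
          nlinarith
        nlinarith
      · rw [Set.indicator_of_notMem hxR, hθz x hxR]; simp
    refine h1.trans ?_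
    rw [integral_indicator hCm, setIntegral_const, smul_eq_mul, mul_comm]
  have hn : ∀ n, 0 ≤ (∫ x, ‖fderiv ℝ u x‖ ^ p) + s * B * volume.real (Metric.closedBall x0 R) -
      (∫ x, F n x) + ∫ x, V x * |v n x| ^ p := by
    intro n
    have h0 := hnn _ (hvt n)
    rw [aux_Q hp (hvt n)] at h0
    obtain ⟨_, _, hi1', _, _⟩ := aux_test_facts hp (hvt n)
    rw [integral_add hi1' (aux_QI hp hV (hvt n))] at h0
    have hci : Integrable (fun x => s * (Metric.closedBall x0 R).indicator (fun _ => B) x) :=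
      ((integrable_indicator_iff hCm).2 (integrableOn_const hCfin)).const_mul _
    have h1 : ∫ x, ‖fderiv ℝ (v n) x‖ ^ p ≤
        ∫ x, (‖fderiv ℝ u x‖ ^ p + s * (Metric.closedBall x0 R).indicator (fun _ => B) x - F n x) :=
      integral_mono hi1' ((hi1.add hci).sub (hFint n))
        (fun x => auxv_grad hp hs hrR hB0 hu hθs hθ0 hθr hθR hθd (hδ n) x)
    have h2 : ∫ x, (‖fderiv ℝ u x‖ ^ p + s * (Metric.closedBall x0 R).indicator (fun _ => B) x - F n x)
        = (∫ x, ‖fderiv ℝ u x‖ ^ p) + s * B * volume.real (Metric.closedBall x0 R) -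
      (∫ x, F n x) := by
      rw [show s * B * volume.real (Metric.closedBall x0 R) =
        ∫ x, s * (Metric.closedBall x0 R).indicator (fun _ => B) x by
          rw [integral_const_mul, integral_indicator hCm, setIntegral_const, smul_eq_mul]; ring,
        ← integral_add hi1 hci]
      exact integral_sub (hi1.add hci) (hFint n)
    linarith
  have hlim := ge_of_tendsto' ((hFlim.const_sub ((∫ x, ‖fderiv ℝ u x‖ ^ p) +
    s * B * volume.real (Metric.closedBall x0 R))).add hvlim) hn
  rw [integral_indicator hBm] at hlim
  rw [aux_Q hp hu, integral_add hi1 hVu]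
  have : s * (B + M) * volume.real (Metric.closedBall x0 R) =
    s * B * volume.real (Metric.closedBall x0 R) + s * M * volume.real (Metric.closedBall x0 R) := by ring
  linarith

lemma aux_bern {p l : ℝ} (hp : 1 < p) (h0 : 0 ≤ l) (h1 : l ≤ 1) :
    min 1 (p - 1) * (1 - l) ≤ 1 - l ^ (p - 1) := by
  rcases le_total 1 (p - 1) with h | h
  · rw [min_eq_left h, one_mul]
    have : l ^ (p - 1) ≤ l := by
      rcases h0.eq_or_lt with h2 | h2
      · rw [← h2, Real.zero_rpow (by linarith)]
      · calc l ^ (p - 1) ≤ l ^ (1 : ℝ) := Real.rpow_le_rpow_of_exponent_ge h2 h1 h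
          _ = l := Real.rpow_one l
    linarith
  · rw [min_eq_right h]
    have := rpow_one_add_le_one_add_mul_self (s := l - 1) (by linarith) (p := p - 1) (by linarith) h
    rw [show 1 + (l - 1) = l by ring] at this
    linarith

lemma aux_phireal {p s w : ℝ} (hp : 1 < p) (hs : 0 < s) (hw : 0 ≤ w) :
    ((w ^ p + s)⁻¹ * (p * (w ^ (p - 2) * w))) ^ p ≤
      p ^ p / (min 1 (p - 1) * s) * (1 - (w ^ p / (w ^ p + s)) ^ (p - 1)) := by
  have hp0 : 0 < p := by linarith
  have hwp : 0 ≤ w ^ p := by positivity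
  set X := w ^ p + s with hX
  have hX0 : 0 < X := by positivity
  have e1 : w ^ (p - 2) * w = w ^ (p - 1) := by
    rcases hw.eq_or_lt with h | h
    · rw [← h, Real.zero_rpow (by linarith : p - 1 ≠ 0), mul_zero]
    · rw [← Real.rpow_add_one h.ne']; ring_nf
  have e2 : (w ^ (p - 1)) ^ p ≤ X ^ (p - 1) := by
    rw [← Real.rpow_mul hw, mul_comm, Real.rpow_mul hw]
    exact Real.rpow_le_rpow hwp (by linarith) (by linarith)
  have hc : 0 < min 1 (p - 1) := lt_min one_pos (by linarith)
  have hb := aux_bern hp (l := w ^ p / X) (by positivity) (by rw [div_le_one hX0]; linarith)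
  have e3 : 1 - w ^ p / X = s / X := by field_simp; rw [hX]; ring
  rw [e3] at hb
  calc (X⁻¹ * (p * (w ^ (p - 2) * w))) ^ p = (X ^ p)⁻¹ * (p ^ p * (w ^ (p - 1)) ^ p) := by
        rw [e1, Real.mul_rpow (by positivity) (by positivity), Real.mul_rpow hp0.le (by positivity),
          Real.inv_rpow hX0.le]
    _ ≤ (X ^ p)⁻¹ * (p ^ p * X ^ (p - 1)) := by gcongr
    _ = p ^ p / (min 1 (p - 1) * s) * (min 1 (p - 1) * (s / X)) := by
        rw [Real.rpow_sub_one hX0.ne']; field_simp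
    _ ≤ _ := by gcongr

lemma aux_Phi {d : ℕ} {p s : ℝ} {u : Ed d → ℝ} (hp : 1 < p) (hs : 0 < s)
    (hu : ContDiff ℝ (⊤ : ℕ∞) u) : ContDiff ℝ 1 (fun x => Real.log (|u x| ^ p + s)) ∧
      ∀ x, ‖fderiv ℝ (fun x => Real.log (|u x| ^ p + s)) x‖ ^ p ≤ p ^ p / (min 1 (p - 1) * s) *
        ((1 - (|u x| ^ p / (|u x| ^ p + s)) ^ (p - 1)) * ‖fderiv ℝ u x‖ ^ p) := by
  have hX : ∀ x, 0 < |u x| ^ p + s := fun x => by positivity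
  constructor
  · apply ContDiff.log
    · refine ContDiff.add ?_ contDiff_const
      exact (contDiff_norm_rpow (E := ℝ) hp).comp (hu.of_le (by exact_mod_cast le_top))
    · exact fun x => (hX x).ne'
  · intro x
    have h2 := (hu.differentiable (by simp) x).hasFDerivAt
    have h3 := (((hasDerivAt_abs_rpow (u x) hp).comp_hasFDerivAt x h2).add_const s).log (hX x).ne'
    have h4 : fderiv ℝ (fun x => Real.log (|u x| ^ p + s)) x = _ := h3.fderiv
    rw [h4, norm_smul, norm_smul]
    have e : ‖((fun x => |x| ^ p) ∘ u) x + s‖ = |u x| ^ p + s := Real.norm_of_nonneg (hX x).le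
    rw [norm_inv]
    simp only [Function.comp] at *
    rw [e, norm_mul, norm_mul, Real.norm_of_nonneg (by linarith : 0 ≤ p), Real.norm_eq_abs (u x),
      Real.norm_of_nonneg (by positivity : 0 ≤ |u x| ^ (p - 2)), ← mul_assoc, ← mul_assoc,
      Real.mul_rpow (by positivity) (norm_nonneg _)]
    have := mul_le_mul_of_nonneg_right (aux_phireal hp hs (abs_nonneg (u x)))
      (by positivity : 0 ≤ ‖fderiv ℝ u x‖ ^ p)
    rw [← mul_assoc, ← mul_assoc] at this
    rw [mul_assoc _ _ (‖fderiv ℝ u x‖ ^ p)] at this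
    rw [← mul_assoc (|u x| ^ p + s)⁻¹]
    exact this

lemma aux_ballvol {d : ℕ} (x : Ed d) {r : ℝ} (hr : 0 < r) :
    volume.real (Metric.ball x r) = r ^ d * volume.real (Metric.ball (0 : Ed d) 1) := by
  rw [Measure.real, Measure.addHaar_ball_of_pos _ _ hr, ENNReal.toReal_mul,
    ENNReal.toReal_ofReal (by positivity), finrank_euclideanSpace, Fintype.card_fin, Measure.real]

lemma aux_ballvol_pos {d : ℕ} (x : Ed d) {r : ℝ} (hr : 0 < r) :
    0 < volume.real (Metric.ball x r) :=
  ENNReal.toReal_pos (Metric.measure_ball_pos _ _ hr).ne' measure_ball_lt_top.ne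

lemma aux_cball {d : ℕ} (x : Ed d) {r : ℝ} (hr : 0 < r) :
    volume.real (Metric.closedBall x (2 * r)) ≤ 4 ^ d * volume.real (Metric.ball x r) := by
  calc volume.real (Metric.closedBall x (2 * r)) ≤ volume.real (Metric.ball x (4 * r)) :=
        measureReal_mono (Metric.closedBall_subset_ball (by linarith)) measure_ball_lt_top.ne
    _ = _ := by rw [aux_ballvol x (by linarith : 0 < 4 * r), aux_ballvol x hr, mul_pow]; ring

lemma aux_logball (p : ℝ) (hp : 1 < p) (d : ℕ) (M : ℝ) (hM : 0 ≤ M) : ∃ C : ℝ, 0 < C ∧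
    ∀ (Ω : Set (Ed d)) (V u : Ed d → ℝ)
    (x0 : Ed d) (r s : ℝ), LocBddOn Ω V → NonnegOn p Ω V → IsTestOn Ω u → 0 < r → r ≤ 1 →
    Metric.closedBall x0 (2 * r) ⊆ Ω → 0 < s →
    (∀ᵐ x ∂(volume : Measure (Ed d)), x ∈ Metric.closedBall x0 (2 * r) → |V x| ≤ M) →
    Qp p Ω V u * r ^ p ≤ s * volume.real (Metric.ball x0 r) →
    ∫⁻ z in Metric.ball x0 r, ENNReal.ofReal (‖fderiv ℝ (fun x => Real.log (|u x| ^ p + s)) z‖ ^ p) ≤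
      ENNReal.ofReal (C * r ^ (-p) * volume.real (Metric.ball x0 r)) := by
  obtain ⟨A, hA, hlog⟩ := aux_log p hp
  have hp0 : 0 < p := by linarith
  have hc : 0 < min 1 (p - 1) := lt_min one_pos (by linarith)
  refine ⟨p ^ p / min 1 (p - 1) * (1 + (A ^ p + M) * 4 ^ d), by positivity, ?_⟩
  intro Ω V u x0 r s hV hnn hu hr hr1 hRΩ hs hVM hQ
  have h1 := hlog d Ω V u x0 r (2 * r) M s hV hnn hu hr (by linarith) hRΩ hs hM hVM
  rw [show 2 * r - r = r by ring] at h1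
  obtain ⟨hΦ, hΦd⟩ := aux_Phi hp hs hu.1
  obtain ⟨hc1, hc2, hi1, hi2, hz⟩ := aux_test_facts hp hu
  have hcont : Continuous (fun x => ‖fderiv ℝ (fun x => Real.log (|u x| ^ p + s)) x‖ ^ p) :=
    (hΦ.continuous_fderiv (by simp)).norm.rpow_const (fun _ => Or.inr (by linarith))
  have hcont2 : Continuous (fun x => (1 - (|u x| ^ p / (|u x| ^ p + s)) ^ (p - 1)) * ‖fderiv ℝ u x‖ ^ p) := by
    refine (continuous_const.sub ((hc2.div (hc2.add continuous_const) ?_).rpow_const ?_)).mul hc1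
    · intro x; exact (by positivity : 0 < |u x| ^ p + s).ne'
    · intro x; right; linarith
  have hint : ∀ f : Ed d → ℝ, Continuous f → IntegrableOn f (Metric.ball x0 r) := fun f hf =>
    (hf.continuousOn.integrableOn_compact (isCompact_closedBall x0 r)).mono_set
      Metric.ball_subset_closedBall
  rw [← ofReal_integral_eq_lintegral_ofReal (hint _ hcont)
    (Eventually.of_forall fun x => by positivity)]
  apply ENNReal.ofReal_le_ofReal
  calc _ ≤ ∫ x in Metric.ball x0 r, p ^ p / (min 1 (p - 1) * s) *
        ((1 - (|u x| ^ p / (|u x| ^ p + s)) ^ (p - 1)) * ‖fderiv ℝ u x‖ ^ p) :=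
        integral_mono (hint _ hcont) ((hint _ hcont2).const_mul _) hΦd
    _ = p ^ p / (min 1 (p - 1) * s) * ∫ x in Metric.ball x0 r,
        ((1 - (|u x| ^ p / (|u x| ^ p + s)) ^ (p - 1)) * ‖fderiv ℝ u x‖ ^ p) := integral_const_mul _ _
    _ ≤ p ^ p / (min 1 (p - 1) * s) * (s * r ^ (-p) * volume.real (Metric.ball x0 r) +
        s * (A ^ p * r ^ (-p) + M * r ^ (-p)) * (4 ^ d * volume.real (Metric.ball x0 r))) := by
        gcongr
        refine h1.trans ?_
        have hrp : 0 < r ^ p := by positivity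
        gcongr
        · rw [Real.rpow_neg hr.le]
          rw [mul_right_comm, ← div_eq_mul_inv, le_div_iff₀ hrp]
          exact hQ
        · rw [Real.div_rpow hA.le hr.le, Real.rpow_neg hr.le]
          rfl
        · rw [Real.rpow_neg hr.le]
          refine le_mul_of_one_le_right hM ((one_le_inv₀ hrp).2 (Real.rpow_le_one hr.le hr1 hp0.le))
        · exact aux_cball x0 hr
    _ = _ := by field_simp

lemma aux_spread (p : ℝ) (hp : 1 < p) (d : ℕ) (M η ε : ℝ) (hM : 0 ≤ M) (hη : 0 < η) (hε : 0 < ε) :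
    ∃ D : ℝ, 1 ≤ D ∧
    ∀ (Ω : Set (Ed d)) (V u : Ed d → ℝ)
    (x0 : Ed d) (r s T : ℝ), LocBddOn Ω V → NonnegOn p Ω V → IsTestOn Ω u → 0 < r → r ≤ 1 →
    Metric.closedBall x0 (2 * r) ⊆ Ω → 0 < s → 0 < T →
    (∀ᵐ x ∂(volume : Measure (Ed d)), x ∈ Metric.closedBall x0 (2 * r) → |V x| ≤ M) →
    Qp p Ω V u * r ^ p ≤ s * volume.real (Metric.ball x0 r) →
    η * volume.real (Metric.ball x0 r) ≤ volume.real (Metric.ball x0 r ∩ {x | |u x| ^ p + s ≤ T}) →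
    volume.real (Metric.ball x0 r ∩ {x | D * T < |u x| ^ p + s}) ≤
      ε * volume.real (Metric.ball x0 r) := by
  obtain ⟨C, hC, hlog⟩ := aux_logball p hp d M hM
  have hp0 : 0 < p := by linarith
  set E := 2 ^ p * 2 ^ d * C with hE
  have hE0 : 0 < E := by positivity
  set N := (E / (η * ε)) ^ (1 / p) with hN
  have hN0 : 0 < N := by positivity
  have hNp : N ^ p = E / (η * ε) := by
    rw [hN, ← Real.rpow_mul (by positivity), one_div_mul_cancel hp0.ne', Real.rpow_one]
  refine ⟨Real.exp N, Real.one_le_exp hN0.le, ?_⟩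
  intro Ω V u x0 r s T hV hnn hu hr hr1 hRΩ hs hT hVM hQ hgood
  have h1 := hlog Ω V u x0 r s hV hnn hu hr hr1 hRΩ hs hVM hQ
  have h2 := aux_meas hp _ (aux_Phi hp hs hu.1).1 x0 hr (Real.log T) N hN0.le
  have hX : ∀ x, 0 < |u x| ^ p + s := fun x => by positivity
  have e1 : {x | Real.log (|u x| ^ p + s) ≤ Real.log T} = {x | |u x| ^ p + s ≤ T} := by
    ext x; exact Real.log_le_log_iff (hX x) hT
  have e2 : {x | Real.log T + N < Real.log (|u x| ^ p + s)} = {x | Real.exp N * T < |u x| ^ p + s} := by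
    ext x
    simp only [Set.mem_ofPred_eq]
    rw [Real.lt_log_iff_exp_lt (hX x), Real.exp_add, Real.exp_log hT, mul_comm]
  rw [e1, e2] at h2
  set b := volume.real (Metric.ball x0 r) with hb
  have hb0 : 0 < b := aux_ballvol_pos x0 hr
  set g := Metric.ball x0 r ∩ {x | |u x| ^ p + s ≤ T} with hg
  set bd := Metric.ball x0 r ∩ {x | Real.exp N * T < |u x| ^ p + s} with hbd
  have hBt : volume (Metric.ball x0 r) ≠ ⊤ := measure_ball_lt_top.ne
  have hgt : volume g ≠ ⊤ := (lt_of_le_of_lt (measure_mono Set.inter_subset_left) hBt.lt_top).ne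
  have hbt : volume bd ≠ ⊤ := (lt_of_le_of_lt (measure_mono Set.inter_subset_left) hBt.lt_top).ne
  have h3 : ENNReal.ofReal (N ^ p * (volume.real g * volume.real bd)) ≤
      ENNReal.ofReal ((2 * r) ^ p * (2 ^ d * b * (C * r ^ (-p) * b))) := by
    rw [ENNReal.ofReal_mul (by positivity), ENNReal.ofReal_mul (by positivity),
      ENNReal.ofReal_mul (by positivity), ENNReal.ofReal_mul (by positivity),
      ENNReal.ofReal_mul (by positivity), ENNReal.ofReal_pow (by positivity),
      ofReal_measureReal hgt, ofReal_measureReal hbt, hb, ofReal_measureReal hBt,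
      show ENNReal.ofReal 2 = 2 by simp]
    refine h2.trans ?_
    gcongr
  rw [ENNReal.ofReal_le_ofReal_iff (by positivity)] at h3
  have h4 : (2 * r) ^ p * (2 ^ d * b * (C * r ^ (-p) * b)) = E * b * b := by
    have hrp : 0 < r ^ p := by positivity
    rw [Real.mul_rpow (by norm_num) hr.le, Real.rpow_neg hr.le, hE]
    field_simp
  rw [h4, hNp] at h3
  have h5 : E / (η * ε) * (η * b * volume.real bd) ≤ E * b * b := by
    refine le_trans ?_ h3
    gcongr
  have h6 : E / (η * ε) * (η * b * volume.real bd) = E * b * (volume.real bd / ε) := by field_simp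
  rw [h6] at h5
  have h7 := le_of_mul_le_mul_left h5 (by positivity)
  rw [div_le_iff₀ hε] at h7
  linarith

lemma aux_halve (p : ℝ) (hp : 1 < p) (d : ℕ) (M η : ℝ) (hM : 0 ≤ M) (hη : 0 < η) :
    ∃ D : ℝ, 1 ≤ D ∧
    ∀ (Ω : Set (Ed d)) (V u : Ed d → ℝ)
    (x0 y : Ed d) (r s T : ℝ), LocBddOn Ω V → NonnegOn p Ω V → IsTestOn Ω u → 0 < r → r ≤ 1 →
    Metric.closedBall x0 (2 * r) ⊆ Ω → 0 < s → 0 < T →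
    (∀ᵐ x ∂(volume : Measure (Ed d)), x ∈ Metric.closedBall x0 (2 * r) → |V x| ≤ M) →
    Qp p Ω V u * r ^ p ≤ s * volume.real (Metric.ball x0 r) →
    Metric.ball y (r / 2) ⊆ Metric.ball x0 r →
    η * volume.real (Metric.ball x0 r) ≤ volume.real (Metric.ball x0 r ∩ {x | |u x| ^ p + s ≤ T}) →
    1 / 2 * volume.real (Metric.ball y (r / 2)) ≤
      volume.real (Metric.ball y (r / 2) ∩ {x | |u x| ^ p + s ≤ D * T}) := by
  obtain ⟨D, hD, h⟩ := aux_spread p hp d M η ((1 / 2) * (1 / 2) ^ d) hM hη (by positivity)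
  refine ⟨D, hD, ?_⟩
  intro Ω V u x0 y r s T hV hnn hu hr hr1 hRΩ hs hT hVM hQ hsub hgood
  have h1 := h Ω V u x0 r s T hV hnn hu hr hr1 hRΩ hs hT hVM hQ hgood
  have e : (1 / 2) * (1 / 2) ^ d * volume.real (Metric.ball x0 r) =
      1 / 2 * volume.real (Metric.ball y (r / 2)) := by
    rw [aux_ballvol x0 hr, aux_ballvol y (by linarith : 0 < r / 2), div_pow, div_pow]; ring
  rw [e] at h1
  have hBt : volume (Metric.ball y (r / 2)) ≠ ⊤ := measure_ball_lt_top.ne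
  have hm : MeasurableSet {x | |u x| ^ p + s ≤ D * T} := by
    have := (aux_test_facts hp hu).2.1
    exact (isClosed_le (this.add continuous_const) continuous_const).measurableSet
  have h2 := measureReal_inter_add_sdiff (μ := volume) (s := Metric.ball y (r / 2)) hm hBt
  have h3 : volume.real (Metric.ball y (r / 2) \ {x | |u x| ^ p + s ≤ D * T}) ≤
      volume.real (Metric.ball x0 r ∩ {x | D * T < |u x| ^ p + s}) := by
    apply measureReal_mono
    · rintro x ⟨hx1, hx2⟩
      exact ⟨hsub hx1, by simpa using hx2⟩
    · exact (lt_of_le_of_lt (measure_mono Set.inter_subset_left) measure_ball_lt_top).ne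
  linarith

lemma aux_chain (p : ℝ) (hp : 1 < p) (d : ℕ) (Ω : Set (Ed d)) (V : Ed d → ℝ) (hV : LocBddOn Ω V)
    (hnn : NonnegOn p Ω V) (x : Ed d) (R : ℝ) (hR : 0 < R) (hR1 : R ≤ 1)
    (hsub : Metric.closedBall x (2 * R) ⊆ Ω) (M : ℝ) (hM : 0 ≤ M)
    (hVM : ∀ᵐ z ∂(volume : Measure (Ed d)), z ∈ Metric.closedBall x (2 * R) → |V z| ≤ M)
    (G : Set (Ed d)) (hGm : MeasurableSet G) (hG : G ⊆ Metric.ball x R) (hGpos : 0 < volume.real G)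
    (CG : ℝ) (hCG : 0 ≤ CG) :
    ∃ T0 D : ℝ, 0 < T0 ∧ 1 ≤ D ∧ ∀ (u : Ed d → ℝ) (s : ℝ), IsTestOn Ω u → 0 < s → Qp p Ω V u ≤ s →
      ∫ z in G, |u z| ^ p ≤ CG * s → ∀ (k : ℕ) (y : Ed d), y ∈ Metric.ball x (R / 2) →
      1 / 2 * volume.real (Metric.ball y (R / 2 ^ (k + 1))) ≤
        volume.real (Metric.ball y (R / 2 ^ (k + 1)) ∩ {z | |u z| ^ p ≤ T0 * D ^ k * s}) := by
  have hp0 : 0 < p := by linarith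
  set ω := volume.real (Metric.ball (0 : Ed d) 1) with hω
  have hω0 : 0 < ω := aux_ballvol_pos _ one_pos
  have hBR : 0 < volume.real (Metric.ball x R) := aux_ballvol_pos _ hR
  set η0 := volume.real G / (2 * volume.real (Metric.ball x R)) with hη0
  have hη0p : 0 < η0 := by positivity
  obtain ⟨D0, hD0, H0⟩ := aux_halve p hp d M η0 hM hη0p
  obtain ⟨D1, hD1, H1⟩ := aux_halve p hp d M (1 / 2) hM (by norm_num)
  set T := (2 * CG + 1) / volume.real G with hT
  have hT0 : 0 < T := by positivity
  have hD0' : 0 < D0 := by linarith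
  have hD1' : 0 < D1 := by linarith
  refine ⟨D0 * (T * ω + 1) * 2 ^ d / (ω * R ^ d), D1 * 2 ^ d, by positivity,
    one_le_mul_of_one_le_of_one_le hD1 (one_le_pow₀ (by norm_num)), ?_⟩
  intro u s hu hs hQ hGu k y hy
  obtain ⟨hc1, hc2, hi1, hi2, hz⟩ := aux_test_facts hp hu
  have hQ0 := hnn u hu
  set l : ℕ → ℝ := fun i => R / 2 ^ (i + 1) with hl
  have hl0 : ∀ i, 0 < l i := fun i => by simp only [hl]; positivity
  have hlR : ∀ i, l i ≤ R / 2 := fun i => by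
    simp only [hl, pow_succ]
    gcongr
    have : (1:ℝ) ≤ 2 ^ i := one_le_pow₀ (by norm_num)
    linarith
  have hlk : ∀ i, i ≤ k → l k ≤ l i := fun i hi => by
    simp only [hl]
    gcongr
    norm_num
  have hlh : ∀ i, l (i + 1) = l i / 2 := fun i => by
    simp only [hl, pow_succ]; field_simp
  set b := l k ^ d * ω with hb
  have hb0 : 0 < b := by have := hl0 k; positivity
  set s' := s / b with hs'
  have hs'0 : 0 < s' := by positivity
  have hss' : s = s' * b := by rw [hs']; field_simp
  have hQr : ∀ (z : Ed d) (r : ℝ), l k ≤ r → r ≤ 1 → Qp p Ω V u * r ^ p ≤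
      s' * volume.real (Metric.ball z r) := by
    intro z r h1 h2
    have hr0 : 0 < r := lt_of_lt_of_le (hl0 k) h1
    rw [aux_ballvol z hr0]
    calc Qp p Ω V u * r ^ p ≤ Qp p Ω V u * 1 := by
          gcongr; exact Real.rpow_le_one hr0.le h2 hp0.le
      _ ≤ s' * (l k ^ d * ω) := by rw [mul_one, ← hb, ← hss']; exact hQ
      _ ≤ _ := by
        have := hl0 k
        gcongr
  have hsT : T * s + s' ≤ (T * ω + 1) * s' := by
    have h1 : b ≤ ω := by
      have : l k ^ d ≤ 1 := pow_le_one₀ (hl0 k).le ((hlR k).trans (by linarith))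
      rw [hb]; exact mul_le_of_le_one_left hω0.le this
    have h2 : s ≤ s' * ω := by rw [hss']; gcongr
    have h3 : T * s ≤ T * (s' * ω) := by gcongr
    nlinarith
  -- Chebyshev
  have hbase : η0 * volume.real (Metric.ball x R) ≤
      volume.real (Metric.ball x R ∩ {z | |u z| ^ p + s' ≤ (T * ω + 1) * s'}) := by
    have hGt : volume G ≠ ⊤ := (lt_of_le_of_lt (measure_mono hG) measure_ball_lt_top).ne
    have hm : MeasurableSet {z | |u z| ^ p ≤ T * s} :=
      (isClosed_le hc2 continuous_const).measurableSet
    have h1 := mul_meas_ge_le_integral_of_nonneg (μ := volume.restrict G)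
      (f := fun z => |u z| ^ p) (Eventually.of_forall fun z => by positivity) hi2.integrableOn (T * s)
    have h2 := measureReal_inter_add_sdiff (μ := volume) (s := G) hm hGt
    have h3 : volume.real (G \ {z | |u z| ^ p ≤ T * s}) ≤
        (volume.restrict G).real {z | T * s ≤ |u z| ^ p} := by
      rw [measureReal_restrict_apply (isClosed_le continuous_const hc2).measurableSet]
      apply measureReal_mono
      · rintro z ⟨hz1, hz2⟩
        refine ⟨?_, hz1⟩
        have hz3 : T * s < |u z| ^ p := by simpa using hz2
        exact (by simpa using hz3.le)
      · exact (lt_of_le_of_lt (measure_mono Set.inter_subset_right) hGt.lt_top).ne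
    have h4 : volume.real (G \ {z | |u z| ^ p ≤ T * s}) ≤ volume.real G / 2 := by
      have h5 : T * s * volume.real (G \ {z | |u z| ^ p ≤ T * s}) ≤ CG * s :=
        le_trans (by gcongr) (h1.trans hGu)
      have h6 : T * volume.real (G \ {z | |u z| ^ p ≤ T * s}) ≤ CG := by
        have : s * (T * volume.real (G \ {z | |u z| ^ p ≤ T * s})) ≤ s * CG := by linarith
        exact le_of_mul_le_mul_left this hs
      have h7 : CG ≤ T * (volume.real G / 2) := by
        rw [hT]; field_simp; linarith
      exact le_of_mul_le_mul_left (h6.trans h7) hT0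
    have h8 : volume.real (G ∩ {z | |u z| ^ p ≤ T * s}) ≤
        volume.real (Metric.ball x R ∩ {z | |u z| ^ p + s' ≤ (T * ω + 1) * s'}) := by
      apply measureReal_mono
      · rintro z ⟨hz1, hz2⟩
        have hz3 : |u z| ^ p ≤ T * s := by simpa using hz2
        exact ⟨hG hz1, (by linarith : |u z| ^ p + s' ≤ (T * ω + 1) * s')⟩
      · exact (lt_of_le_of_lt (measure_mono Set.inter_subset_left) measure_ball_lt_top).ne
    have h9 : η0 * volume.real (Metric.ball x R) = volume.real G / 2 := by rw [hη0]; field_simp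
    linarith
  have hchain : ∀ i, i ≤ k → 1 / 2 * volume.real (Metric.ball y (l i)) ≤
      volume.real (Metric.ball y (l i) ∩
        {z | |u z| ^ p + s' ≤ D1 ^ i * (D0 * ((T * ω + 1) * s'))}) := by
    intro i
    induction i with
    | zero =>
      intro _
      have e : l 0 = R / 2 := by simp [hl]
      rw [e, pow_zero, one_mul]
      refine H0 Ω V u x y R s' ((T * ω + 1) * s') hV hnn hu hR hR1 hsub hs'0 (by positivity) hVM
        (hQr x R ((hlR k).trans (by linarith)) hR1) ?_ hbase
      apply Metric.ball_subset_ball'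
      rw [Metric.mem_ball] at hy
      linarith
    | succ i ih =>
      intro hi
      have h1 := ih (by omega)
      have hcb : Metric.closedBall y (2 * l i) ⊆ Metric.closedBall x (2 * R) := by
        apply Metric.closedBall_subset_closedBall'
        rw [Metric.mem_ball] at hy
        linarith [hlR i]
      rw [hlh, pow_succ', mul_assoc]
      refine H1 Ω V u y y (l i) s' _ hV hnn hu (hl0 i) ((hlR i).trans (by linarith))
        (hcb.trans hsub) hs'0 (by positivity) ?_
        (hQr y _ (hlk i (by omega)) ((hlR i).trans (by linarith))) ?_ h1
      · filter_upwards [hVM] with z hz hz2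
        exact hz (hcb hz2)
      · exact Metric.ball_subset_ball (by linarith [hl0 i])
  refine (hchain k le_rfl).trans ?_
  apply measureReal_mono
  · rintro z ⟨hz1, hz2⟩
    refine ⟨hz1, ?_⟩
    have hz3 : |u z| ^ p + s' ≤ D1 ^ k * (D0 * ((T * ω + 1) * s')) := by simpa using hz2
    have e : D1 ^ k * (D0 * ((T * ω + 1) * s')) =
        D0 * (T * ω + 1) * 2 ^ d / (ω * R ^ d) * (D1 * 2 ^ d) ^ k * s := by
      rw [hs', hb]
      simp only [hl]
      rw [div_pow, mul_pow, ← pow_mul, ← pow_mul, mul_comm d k, show (k + 1) * d = k * d + d by ring, pow_add (2:ℝ)]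
      field_simp
    have : |u z| ^ p ≤ D0 * (T * ω + 1) * 2 ^ d / (ω * R ^ d) * (D1 * 2 ^ d) ^ k * s := by
      rw [← e]; linarith
    exact this
  · exact (lt_of_le_of_lt (measure_mono Set.inter_subset_left) measure_ball_lt_top).ne

lemma aux_sup (a : ℕ → ℝ) (I L : ℝ) (hI : ∀ j, a j ≤ I) (h : ∀ j, a j ≤ 1 / 2 * a (j + 1) + L) :
    a 0 ≤ 2 * L := by
  have hb : BddAbove (Set.range a) := ⟨I, by rintro _ ⟨j, rfl⟩; exact hI j⟩
  have h1 : ⨆ j, a j ≤ 1 / 2 * (⨆ j, a j) + L := by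
    apply ciSup_le
    intro j
    have := le_ciSup hb (j + 1)
    linarith [h j]
  have := le_ciSup hb 0
  linarith

lemma aux_step (p : ℝ) (hp : 1 < p) (d : ℕ) (Ω : Set (Ed d)) (u : Ed d → ℝ) (hu : IsTestOn Ω u)
    (x : Ed d) (ρ l m : ℝ) (hρ : 0 < ρ) (hl : 0 < l) (hρl : ρ + l ≤ 1) (hm : 0 ≤ m)
    (h : ∀ y ∈ Metric.ball x (ρ + l), 1 / 2 * volume.real (Metric.ball y l) ≤
        volume.real (Metric.ball y l ∩ {z | |u z| ^ p ≤ m})) :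
    ∫ z in Metric.ball x ρ, |u z| ^ p ≤ 2 ^ (p - 1) * ((2 * l) ^ p * (2 ^ d * 2 *
      ∫ z in Metric.ball x (ρ + 2 * l), ‖fderiv ℝ u z‖ ^ p) +
        m * volume.real (Metric.ball (0 : Ed d) 1)) := by
  have hp0 : 0 < p := by linarith
  obtain ⟨hc1, hc2, hi1, hi2, hz⟩ := aux_test_facts hp hu
  have hu1 : ContDiff ℝ 1 u := hu.1.of_le (by exact_mod_cast le_top)
  have hG : ∀ y ∈ Metric.ball x (ρ + l), volume (Metric.ball y l) ≤
      2 * volume (Metric.ball y l ∩ {z | ENNReal.ofReal (|u z| ^ p) ≤ ENNReal.ofReal m}) := by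
    intro y hy
    have h1 := h y hy
    have e : {z | ENNReal.ofReal (|u z| ^ p) ≤ ENNReal.ofReal m} = {z | |u z| ^ p ≤ m} := by
      ext z; exact ENNReal.ofReal_le_ofReal_iff hm
    rw [e]
    have hb : volume (Metric.ball y l) ≠ ⊤ := measure_ball_lt_top.ne
    have hb2 : volume (Metric.ball y l ∩ {z | |u z| ^ p ≤ m}) ≠ ⊤ :=
      (lt_of_le_of_lt (measure_mono Set.inter_subset_left) hb.lt_top).ne
    rw [← ENNReal.toReal_le_toReal hb (ENNReal.mul_ne_top (by simp) hb2), ENNReal.toReal_mul]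
    simp only [Measure.real] at h1
    norm_num
    linarith
  have hlp : ∀ y ∈ Metric.ball x (ρ + l), _ := fun y hy =>
    aux_lp hp u hu1 y hl (ENNReal.ofReal m) (hG y hy)
  have ha := (aux_avg_lower (fun z => ENNReal.ofReal (|u z| ^ p)) hc2.measurable.ennreal_ofReal x
    (ρ := ρ) hl).1
  have hb := (aux_avg_lower (fun z => ENNReal.ofReal (‖fderiv ℝ u z‖ ^ p))
    hc1.measurable.ennreal_ofReal x (ρ := ρ) hl).2
  set b := volume (Metric.ball x l) with hbdef
  have hbt : b ≠ ⊤ := measure_ball_lt_top.ne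
  have hb0 : b ≠ 0 := (Metric.measure_ball_pos _ _ hl).ne'
  have hby : ∀ y : Ed d, volume (Metric.ball y l) = b := fun y => by
    rw [hbdef, Measure.addHaar_ball_center, ← Measure.addHaar_ball_center volume x]
  set DI := ∫⁻ z in Metric.ball x (ρ + 2 * l), ENNReal.ofReal (‖fderiv ℝ u z‖ ^ p) with hDI
  have h1 : b * ∫⁻ z in Metric.ball x ρ, ENNReal.ofReal (|u z| ^ p) ≤
      b * (ENNReal.ofReal (2 ^ (p - 1)) * (ENNReal.ofReal ((2 * l) ^ p) * (2 ^ d * 2 * DI) +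
        ENNReal.ofReal m * volume (Metric.ball (0 : Ed d) 1))) := by
    refine ha.trans ?_
    calc _ ≤ ∫⁻ y in Metric.ball x (ρ + l), ENNReal.ofReal (2 ^ (p - 1)) *
          (ENNReal.ofReal ((2 * l) ^ p) * (2 ^ d * 2 * ∫⁻ z in Metric.ball y l,
            ENNReal.ofReal (‖fderiv ℝ u z‖ ^ p)) + b * ENNReal.ofReal m) := by
          apply setLIntegral_mono' Metric.isOpen_ball.measurableSet
          intro y hy
          have := hlp y hy
          rw [hby] at this
          exact this
      _ = ENNReal.ofReal (2 ^ (p - 1)) * (ENNReal.ofReal ((2 * l) ^ p) * (2 ^ d * 2 *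
            ∫⁻ y in Metric.ball x (ρ + l), ∫⁻ z in Metric.ball y l,
            ENNReal.ofReal (‖fderiv ℝ u z‖ ^ p)) + b * ENNReal.ofReal m *
              volume (Metric.ball x (ρ + l))) := by
          rw [lintegral_const_mul' _ _ ENNReal.ofReal_ne_top, lintegral_add_right _ measurable_const,
            lintegral_const_mul' _ _ ENNReal.ofReal_ne_top,
            lintegral_const_mul' _ _ (by finiteness), setLIntegral_const]
      _ ≤ ENNReal.ofReal (2 ^ (p - 1)) * (ENNReal.ofReal ((2 * l) ^ p) * (2 ^ d * 2 *
            (b * DI)) + b * ENNReal.ofReal m * volume (Metric.ball (0 : Ed d) 1)) := by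
          have hvol : volume (Metric.ball x (ρ + l)) ≤ volume (Metric.ball (0 : Ed d) 1) := by
            rw [Measure.addHaar_ball_center volume x]
            exact measure_mono (Metric.ball_subset_ball hρl)
          gcongr
      _ = _ := by ring
  have h2 := (ENNReal.mul_le_mul_iff_right hb0 hbt).1 h1
  have hu_r : ENNReal.ofReal (∫ z in Metric.ball x ρ, |u z| ^ p) =
      ∫⁻ z in Metric.ball x ρ, ENNReal.ofReal (|u z| ^ p) :=
    ofReal_integral_eq_lintegral_ofReal hi2.integrableOn (Eventually.of_forall fun z => by positivity)
  have hd_r : ENNReal.ofReal (∫ z in Metric.ball x (ρ + 2 * l), ‖fderiv ℝ u z‖ ^ p) = DI :=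
    ofReal_integral_eq_lintegral_ofReal hi1.integrableOn (Eventually.of_forall fun z => by positivity)
  have hd0 : 0 ≤ ∫ z in Metric.ball x (ρ + 2 * l), ‖fderiv ℝ u z‖ ^ p :=
    integral_nonneg fun z => by positivity
  rw [← ENNReal.ofReal_le_ofReal_iff (by positivity), hu_r]
  refine h2.trans (le_of_eq ?_)
  rw [ENNReal.ofReal_mul (by positivity), ENNReal.ofReal_add (by positivity) (by positivity),
    ENNReal.ofReal_mul (by positivity), ENNReal.ofReal_mul (by positivity),
    ENNReal.ofReal_mul (by positivity), ENNReal.ofReal_mul (by positivity),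
    ENNReal.ofReal_pow (by positivity), hd_r,
    ofReal_measureReal measure_ball_lt_top.ne, show ENNReal.ofReal 2 = 2 by simp]

set_option maxHeartbeats 1000000 in
lemma aux_main (p : ℝ) (hp : 1 < p) (d : ℕ) (Ω : Set (Ed d)) (V : Ed d → ℝ) (hV : LocBddOn Ω V)
    (hnn : NonnegOn p Ω V) (x : Ed d) (R : ℝ) (hR : 0 < R) (hR1 : R ≤ 1)
    (hsub : Metric.closedBall x (2 * R) ⊆ Ω)
    (G : Set (Ed d)) (hGm : MeasurableSet G) (hG : G ⊆ Metric.ball x R) (hGpos : 0 < volume.real G)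
    (CG : ℝ) (hCG : 0 ≤ CG) :
    ∃ C : ℝ, 0 ≤ C ∧ ∀ (u : Ed d → ℝ) (s : ℝ), IsTestOn Ω u → 0 < s → Qp p Ω V u ≤ s →
      ∫ z in G, |u z| ^ p ≤ CG * s → ∫ z in Metric.ball x (R / 4), |u z| ^ p ≤ C * s := by
  have hp0 : 0 < p := by linarith
  obtain ⟨M', hM'⟩ := hV.2 _ (isCompact_closedBall x (2 * R)) hsub
  set M := |M'| with hMdef
  have hM : 0 ≤ M := abs_nonneg _
  have hVM : ∀ᵐ z ∂(volume : Measure (Ed d)), z ∈ Metric.closedBall x (2 * R) → |V z| ≤ M := by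
    filter_upwards [hM'] with z hz hz2
    exact (hz hz2).trans (le_abs_self _)
  obtain ⟨A, hA, hcacc⟩ := aux_cacc p hp
  obtain ⟨T0, D, hT0, hD, hch⟩ := aux_chain p hp d Ω V hV hnn x R hR hR1 hsub M hM hVM G hGm hG
    hGpos CG hCG
  have hD0 : 0 < D := by linarith
  set ω := volume.real (Metric.ball (0 : Ed d) 1) with hω
  have hω0 : 0 < ω := aux_ballvol_pos _ one_pos
  set c1 := (2:ℝ) ^ (p - 1) with hc1d
  have hc10 : 0 < c1 := by positivity
  set K1 := c1 * (2 ^ d * 2) * ((4 * A) ^ p + 2 ^ p * M) with hK1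
  set K2 := c1 * (2 ^ d * 2) * 2 ^ p + c1 * T0 * ω with hK2
  have hK10 : 0 ≤ K1 := by positivity
  have hK20 : 0 ≤ K2 := by positivity
  obtain ⟨q, hq3, hq⟩ : ∃ q : ℕ, 3 ≤ q ∧ K1 * D * (1 / 2) ^ q ≤ 1 / 2 := by
    have h1 : Tendsto (fun q : ℕ => K1 * D * (1 / 2 : ℝ) ^ q) atTop (𝓝 (K1 * D * 0)) :=
      (tendsto_pow_atTop_nhds_zero_of_lt_one (by norm_num) (by norm_num)).const_mul _
    rw [mul_zero] at h1
    have h2 := (h1.eventually_le_const (by norm_num : (0:ℝ) < 1 / 2)).and (eventually_ge_atTop 3)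
    obtain ⟨q, h3, h4⟩ := h2.exists
    exact ⟨q, h4, h3⟩
  refine ⟨2 * (K2 * D ^ (q + 2)), by positivity, ?_⟩
  intro u s hu hs hQ hGu
  obtain ⟨hc1, hc2, hi1, hi2, hz⟩ := aux_test_facts hp hu
  set ρ : ℕ → ℝ := fun j => R / 2 - R / 4 * (1 / 2) ^ j with hρ
  set g : ℕ → ℝ := fun j => ∫ z in Metric.ball x (ρ j), |u z| ^ p with hg
  set h : ℕ → ℝ := fun j => R / 8 * (1 / 2) ^ j with hh
  have hh0 : ∀ j, 0 < h j := fun j => by simp only [hh]; positivity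
  have hhj : ∀ j, ρ (j + 1) = ρ j + h j := fun j => by simp only [hρ, hh, pow_succ]; ring
  have hρ0 : ∀ j, 0 < ρ j := fun j => by
    simp only [hρ]
    have : (1 / 2 : ℝ) ^ j ≤ 1 := pow_le_one₀ (by norm_num) (by norm_num)
    nlinarith
  have hρ1 : ∀ j, ρ j ≤ R / 2 := fun j => by
    simp only [hρ]
    have : 0 ≤ R / 4 * (1 / 2 : ℝ) ^ j := by positivity
    linarith
  have hg0 : ∀ j, 0 ≤ g j := fun j => integral_nonneg fun z => by positivity
  have hgI : ∀ j, g j ≤ ∫ z, |u z| ^ p := fun j =>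
    setIntegral_le_integral hi2 (Eventually.of_forall fun z => by positivity)
  have hstep : ∀ j, g j ≤ 1 / (2 * D) * g (j + 1) + K2 * D ^ (j + q + 2) * s := by
    intro j
    set l := h j * (1 / 2) ^ q with hl
    have hl0 : 0 < l := by have := hh0 j; positivity
    have hlk : l = R / 2 ^ (j + q + 2 + 1) := by
      simp only [hl, hh, pow_add, one_div, inv_pow]; field_simp; norm_num
    have hl8 : l ≤ h j / 8 := by
      have : (1 / 2 : ℝ) ^ q ≤ (1 / 2) ^ 3 := pow_le_pow_of_le_one (by norm_num) (by norm_num) hq3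
      have := mul_le_mul_of_nonneg_left this (hh0 j).le
      rw [← hl] at this
      linarith
    have hρj := hρ1 (j + 1)
    have hhpos := hh0 j
    rw [hhj] at hρj
    have h1 := aux_step p hp d Ω u hu x (ρ j) l (T0 * D ^ (j + q + 2) * s) (hρ0 j) hl0 (by linarith)
      (by positivity) (by
        intro y hy
        have := hch u s hu hs hQ hGu (j + q + 2) y
          (Metric.ball_subset_ball (by linarith) hy)
        rw [← hlk] at this
        exact this)
    have h2 := hcacc d Ω V u x (ρ j + 2 * l) (ρ j + 3 / 4 * h j) M hV hnn hu (by linarith [hρ0 j])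
      (by linarith) hM (by
        filter_upwards [hVM] with z hz hz2
        exact hz (Metric.closedBall_subset_closedBall (by linarith) hz2))
    have h3 : ∫ z in Metric.closedBall x (ρ j + 3 / 4 * h j), |u z| ^ p ≤ g (j + 1) := by
      apply setIntegral_mono_set hi2.integrableOn (Eventually.of_forall fun z => by positivity)
      apply LE.le.eventuallyLE
      apply Metric.closedBall_subset_ball
      rw [hhj]; linarith
    have h4 : (A / (ρ j + 3 / 4 * h j - (ρ j + 2 * l))) ^ p ≤ (2 * A / h j) ^ p := by
      apply Real.rpow_le_rpow _ _ hp0.le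
      · apply div_nonneg hA.le; linarith
      · rw [div_le_div_iff₀ (by linarith) (by linarith)]
        nlinarith
    have h5 : ∫ z in Metric.ball x (ρ j + 2 * l), ‖fderiv ℝ u z‖ ^ p ≤
        s + ((2 * A / h j) ^ p + M) * g (j + 1) := by
      refine h2.trans ?_
      have h30 : 0 ≤ ∫ z in Metric.closedBall x (ρ j + 3 / 4 * h j), |u z| ^ p :=
        integral_nonneg fun z => by positivity
      gcongr
    have h6 : (2 * l) ^ p * (2 * A / h j) ^ p ≤ (4 * A) ^ p * (1 / 2) ^ q := by
      rw [← Real.mul_rpow (by positivity) (by positivity)]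
      have e : 2 * l * (2 * A / h j) = 4 * A * (1 / 2) ^ q := by
        rw [hl]; field_simp; norm_num
      rw [e, Real.mul_rpow (by positivity) (by positivity)]
      gcongr
      calc ((1 / 2 : ℝ) ^ q) ^ p ≤ ((1 / 2 : ℝ) ^ q) ^ (1 : ℝ) :=
            Real.rpow_le_rpow_of_exponent_ge (by positivity)
              (pow_le_one₀ (by norm_num) (by norm_num)) hp.le
        _ = _ := Real.rpow_one _
    have hh1 : h j ≤ 1 := by
      simp only [hh]
      have : (1 / 2 : ℝ) ^ j ≤ 1 := pow_le_one₀ (by norm_num) (by norm_num)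
      nlinarith
    have h7 : (2 * l) ^ p ≤ 2 ^ p * (1 / 2) ^ q := by
      rw [Real.mul_rpow (by positivity) (by positivity)]
      gcongr
      calc l ^ p ≤ l ^ (1 : ℝ) :=
            Real.rpow_le_rpow_of_exponent_ge (by positivity) (by linarith) hp.le
        _ = l := Real.rpow_one _
        _ ≤ _ := by rw [hl]; exact mul_le_of_le_one_left (by positivity) hh1
    have h8 : (2 * l) ^ p ≤ 2 ^ p := by
      apply Real.rpow_le_rpow (by positivity) _ hp0.le
      linarith
    have hDk : 1 ≤ D ^ (j + q + 2) := one_le_pow₀ hD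
    have h9 : (2 * l) ^ p * ((2 * A / h j) ^ p + M) ≤ ((4 * A) ^ p + 2 ^ p * M) * (1 / 2) ^ q := by
      have := mul_le_mul_of_nonneg_right h7 hM
      rw [mul_add, add_mul]
      linarith
    have h10 : K1 * (1 / 2) ^ q ≤ 1 / (2 * D) := by
      rw [le_div_iff₀ (by positivity)]
      linarith
    calc g j ≤ c1 * ((2 * l) ^ p * (2 ^ d * 2 * (s + ((2 * A / h j) ^ p + M) * g (j + 1))) +
          T0 * D ^ (j + q + 2) * s * ω) := by
          refine h1.trans ?_
          gcongr
      _ = c1 * (2 ^ d * 2) * ((2 * l) ^ p * ((2 * A / h j) ^ p + M)) * g (j + 1) +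
          (c1 * (2 ^ d * 2) * (2 * l) ^ p * 1 + c1 * T0 * ω * D ^ (j + q + 2)) * s := by ring
      _ ≤ c1 * (2 ^ d * 2) * (((4 * A) ^ p + 2 ^ p * M) * (1 / 2) ^ q) * g (j + 1) +
          (c1 * (2 ^ d * 2) * 2 ^ p * D ^ (j + q + 2) + c1 * T0 * ω * D ^ (j + q + 2)) * s := by
          have := hg0 (j + 1)
          gcongr
      _ = K1 * (1 / 2) ^ q * g (j + 1) + K2 * D ^ (j + q + 2) * s := by rw [hK1, hK2]; ring
      _ ≤ _ := by
          have := hg0 (j + 1)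
          gcongr
  have hfin := aux_sup (fun j => g j / D ^ j) (∫ z, |u z| ^ p) (K2 * D ^ (q + 2) * s)
    (fun j => (div_le_self (hg0 j) (one_le_pow₀ hD)).trans (hgI j)) (fun j => by
      have e1 : D ^ (j + q + 2) = D ^ (q + 2) * D ^ j := by rw [← pow_add]; congr 1; ring
      have hDj : 0 < D ^ j := by positivity
      have e2 : 1 / (2 * D) * g (j + 1) = 1 / 2 * (g (j + 1) / D ^ (j + 1)) * D ^ j := by
        rw [pow_succ D j]
        have : D ≠ 0 := by positivity
        have := hDj.ne'
        generalize D ^ j = t at *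
        generalize g (j + 1) = r at *
        field_simp
      have h0 : g j ≤ (1 / 2 * (g (j + 1) / D ^ (j + 1)) + K2 * D ^ (q + 2) * s) * D ^ j := by
        refine (hstep j).trans (le_of_eq ?_)
        rw [e2, e1]
        generalize g (j + 1) / D ^ (j + 1) = r
        rw [hK2]
        ring
      exact (div_le_iff₀ hDj).2 h0)
  simp only [pow_zero, div_one] at hfin
  have e : ρ 0 = R / 4 := by simp only [hρ, pow_zero]; ring
  simp only [hg] at hfin
  rw [e] at hfin
  linarith

lemma aux_diff {d : ℕ} {p η : ℝ} (hp : 1 < p) {Ω : Set (Ed d)} (hopen : IsOpen Ω)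
    {V₁ V₂ : Ed d → ℝ} (hV₁ : LocBddOn Ω V₁) (hV₂ : LocBddOn Ω V₂)
    (hle : ∀ᵐ x ∂(volume.restrict Ω), V₁ x ≤ V₂ x) {u : Ed d → ℝ} (hu : IsTestOn Ω u)
    (G : Set (Ed d)) (hGm : MeasurableSet G) (hG : ∀ x ∈ G, V₁ x + η ≤ V₂ x) :
    η * (∫ x in G, |u x| ^ p) ≤ Qp p Ω V₂ u - Qp p Ω V₁ u := by
  have hp0 : 0 < p := by linarith
  obtain ⟨hc1, hc2, hi1, hi2, hz⟩ := aux_test_facts hp hu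
  have h1 := aux_QI hp hV₁ hu
  have h2 := aux_QI hp hV₂ hu
  rw [aux_Q hp hu, aux_Q hp hu, integral_add hi1 h1, integral_add hi1 h2, add_sub_add_left_eq_sub,
    ← integral_sub h2 h1, ← integral_indicator hGm, ← integral_const_mul]
  apply integral_mono_ae ((hi2.indicator hGm).const_mul η) (h2.sub h1)
  rw [ae_restrict_iff' hopen.measurableSet] at hle
  filter_upwards [hle] with x hx
  simp only [Pi.sub_apply]
  by_cases hxΩ : x ∈ Ω
  · have hup : 0 ≤ |u x| ^ p := by positivity
    by_cases hxG : x ∈ G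
    · rw [Set.indicator_of_mem hxG]
      have := hG x hxG
      nlinarith
    · rw [Set.indicator_of_notMem hxG]
      have := hx hxΩ
      nlinarith
  · have hu0 : u x = 0 := (hz x (fun h => hxΩ (hu.2.2 h))).1
    have e : |u x| ^ p = 0 := by rw [hu0]; simp [hp0.ne']
    have e2 : G.indicator (fun x => |u x| ^ p) x = 0 := by
      by_cases hxG : x ∈ G
      · rw [Set.indicator_of_mem hxG, e]
      · rw [Set.indicator_of_notMem hxG]
    rw [e, e2]; simp

def AuxGood {d : ℕ} (p : ℝ) (Ω : Set (Ed d)) (V : Ed d → ℝ) (x : Ed d) (r C : ℝ) : Prop :=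
  0 < r ∧ 0 ≤ C ∧ ∀ (u : Ed d → ℝ) (s : ℝ), IsTestOn Ω u → 0 < s → Qp p Ω V u ≤ s →
    ∫ z in Metric.ball x r, |u z| ^ p ≤ C * s

lemma aux_good_mono {d : ℕ} {p : ℝ} (hp : 1 < p) {Ω : Set (Ed d)} {V : Ed d → ℝ} {x y : Ed d}
    {r C r' : ℝ} (h : AuxGood p Ω V x r C) (hr' : 0 < r')
    (hsub : Metric.ball y r' ⊆ Metric.ball x r) : AuxGood p Ω V y r' C := by
  refine ⟨hr', h.2.1, fun u s hu hs hQ => le_trans ?_ (h.2.2 u s hu hs hQ)⟩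
  exact setIntegral_mono_set (aux_test_facts hp hu).2.2.2.1.integrableOn
    (Eventually.of_forall fun z => by positivity) (LE.le.eventuallyLE hsub)

lemma aux_assemble {d : ℕ} {p : ℝ} (hp : 1 < p) {Ω : Set (Ed d)} (hne : Ω.Nonempty) {V : Ed d → ℝ}
    (hnn : NonnegOn p Ω V) (hgood : ∀ x ∈ Ω, ∃ r C, AuxGood p Ω V x r C) : SubcriticalOn p Ω V := by
  choose! r C hg using hgood
  obtain ⟨t, htΩ, htc, htcov⟩ := TopologicalSpace.countable_cover_nhdsWithin (s := Ω)
    (f := fun x => Metric.ball x (r x))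
    (fun x hx => mem_nhdsWithin_of_mem_nhds (Metric.ball_mem_nhds x (hg x hx).1))
  have htne : t.Nonempty := by
    obtain ⟨x, hx⟩ := hne
    have := htcov hx
    simp only [Set.mem_iUnion] at this
    obtain ⟨i, hi, _⟩ := this
    exact ⟨i, hi⟩
  obtain ⟨e, he⟩ := htc.exists_eq_range htne
  have heΩ : ∀ i, e i ∈ Ω := fun i => htΩ (by rw [he]; exact Set.mem_range_self i)
  set ζ : ℕ → Ed d → ℝ := fun i z => min 1 (max 0 (r (e i) - dist z (e i))) with hζ
  have hζc : ∀ i, Continuous (ζ i) := fun i => by simp only [hζ]; fun_prop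
  have hζ0 : ∀ i z, 0 ≤ ζ i z := fun i z => le_min zero_le_one (le_max_left _ _)
  have hζ1 : ∀ i z, ζ i z ≤ 1 := fun i z => min_le_left _ _
  set c : ℕ → ℝ := fun i => 1 / 2 / 2 ^ i / (C (e i) + 1) with hc
  have hC0 : ∀ i, 0 ≤ C (e i) := fun i => (hg _ (heΩ i)).2.1
  have hc0 : ∀ i, 0 < c i := fun i => by have := hC0 i; simp only [hc]; positivity
  have hc1 : ∀ i, c i ≤ 1 / 2 / 2 ^ i := fun i =>
    div_le_self (by positivity) (by linarith [hC0 i])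
  have hsum : Summable (fun i : ℕ => (1 / 2 / 2 ^ i : ℝ)) := summable_geometric_two' _
  have hb : ∀ i z, ‖c i * ζ i z‖ ≤ 1 / 2 / 2 ^ i := fun i z => by
    rw [Real.norm_of_nonneg (mul_nonneg (hc0 i).le (hζ0 i z))]
    exact (mul_le_of_le_one_right (hc0 i).le (hζ1 i z)).trans (hc1 i)
  have hsz : ∀ z, Summable (fun i => c i * ζ i z) := fun z =>
    Summable.of_norm_bounded hsum (fun i => hb i z)
  refine ⟨fun z => ∑' i, c i * ζ i z, ?_, ?_, ?_⟩
  · exact (continuous_tsum (fun i => continuous_const.mul (hζc i)) hsum hb).continuousOn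
  · intro z hz
    have := htcov hz
    simp only [Set.mem_iUnion] at this
    obtain ⟨y, hy, hzy⟩ := this
    rw [he] at hy
    obtain ⟨i, rfl⟩ := hy
    refine (hsz z).tsum_pos (fun j => mul_nonneg (hc0 j).le (hζ0 j z)) i (mul_pos (hc0 i) ?_)
    rw [Metric.mem_ball] at hzy
    exact lt_min one_pos (lt_max_of_lt_right (by linarith))
  · intro u hu
    obtain ⟨hcc1, hcc2, hi1, hi2, hz⟩ := aux_test_facts hp hu
    have hQ0 := hnn u hu
    apply le_of_forall_pos_le_add
    intro ε hε
    set s := Qp p Ω V u + ε with hs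
    have hs0 : 0 < s := by linarith
    set F : ℕ → Ed d → ℝ := fun i z => c i * ζ i z * |u z| ^ p with hF
    have hF0 : ∀ i z, 0 ≤ F i z := fun i z => by
      have := hc0 i; have := hζ0 i z; simp only [hF]; positivity
    have hFi : ∀ i, Integrable (F i) := fun i => by
      refine hi2.mono' ((continuous_const.mul (hζc i)).mul hcc2).aestronglyMeasurable
        (Eventually.of_forall fun z => ?_)
      rw [Real.norm_of_nonneg (hF0 i z)]
      refine mul_le_of_le_one_left (by positivity) ?_
      have h1 := hb i z
      rw [Real.norm_eq_abs] at h1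
      have h2 : (1 / 2 / 2 ^ i : ℝ) ≤ 1 := by
        rw [div_le_one (by positivity)]
        have : (1:ℝ) ≤ 2 ^ i := one_le_pow₀ (by norm_num)
        linarith
      exact (le_abs_self _).trans (h1.trans h2)
    have hFb : ∀ i, ∫ z in Ω, F i z ≤ 1 / 2 / 2 ^ i * s := fun i => by
      have hBm : MeasurableSet (Metric.ball (e i) (r (e i))) := Metric.isOpen_ball.measurableSet
      calc ∫ z in Ω, F i z ≤ ∫ z, F i z :=
            setIntegral_le_integral (hFi i) (Eventually.of_forall (hF0 i))
        _ ≤ ∫ z, c i * (Metric.ball (e i) (r (e i))).indicator (fun z => |u z| ^ p) z := by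
            apply integral_mono (hFi i) ((hi2.indicator hBm).const_mul _)
            intro z
            simp only [hF]
            rw [mul_assoc]
            refine mul_le_mul_of_nonneg_left ?_ (hc0 i).le
            by_cases hzB : z ∈ Metric.ball (e i) (r (e i))
            · rw [Set.indicator_of_mem hzB]
              exact mul_le_of_le_one_left (by positivity) (hζ1 i z)
            · rw [Set.indicator_of_notMem hzB]
              have : ζ i z = 0 := by
                rw [Metric.mem_ball, not_lt] at hzB
                simp only [hζ]
                rw [max_eq_left (by linarith), min_eq_right zero_le_one]
              rw [this, zero_mul]
        _ = c i * ∫ z in Metric.ball (e i) (r (e i)), |u z| ^ p := by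
            rw [integral_const_mul, integral_indicator hBm]
        _ ≤ c i * (C (e i) * s) := by
            refine mul_le_mul_of_nonneg_left ?_ (hc0 i).le
            exact (hg _ (heΩ i)).2.2 u s hu hs0 (by linarith)
        _ = c i * C (e i) * s := by ring
        _ ≤ _ := by
            gcongr
            simp only [hc]
            rw [div_mul_eq_mul_div, div_le_iff₀ (by linarith [hC0 i])]
            gcongr
            linarith
    have hFint0 : ∀ i, 0 ≤ ∫ z in Ω, F i z := fun i => integral_nonneg (hF0 i)
    have hsF : Summable (fun i => ∫ z in Ω, F i z) :=
      Summable.of_nonneg_of_le hFint0 hFb (hsum.mul_right s)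
    have hhs := hasSum_integral_of_summable_integral_norm (μ := volume.restrict Ω) (F := F)
      (fun i => (hFi i).integrableOn) (by
        simpa only [Real.norm_of_nonneg (hF0 _ _)] using hsF)
    have e1 : (∫ z in Ω, (∑' i, c i * ζ i z) * |u z| ^ p) = ∫ z in Ω, ∑' i, F i z := by
      congr 1
      ext z
      rw [← tsum_mul_right]
    rw [e1, ← hhs.tsum_eq]
    calc _ ≤ ∑' i : ℕ, (1 / 2 / 2 ^ i : ℝ) * s := hsF.tsum_le_tsum hFb (hsum.mul_right s)
      _ = s := by rw [tsum_mul_right, tsum_geometric_two' , one_mul]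

theorem aux_stmt (d : ℕ) (p : ℝ) (hp : 1 < p) (Ω : Set (Ed d))
    (hopen : IsOpen Ω) (hconn : IsConnected Ω)
    (V₁ V₂ : Ed d → ℝ) (hV₁ : LocBddOn Ω V₁) (hV₂ : LocBddOn Ω V₂)
    (hle : ∀ᵐ x ∂(volume.restrict Ω), V₁ x ≤ V₂ x)
    (hne : 0 < volume {x ∈ Ω | V₁ x ≠ V₂ x})
    (hnn : NonnegOn p Ω V₁) :
    SubcriticalOn p Ω V₂ := by
  have hQ12 : ∀ u, IsTestOn Ω u → Qp p Ω V₁ u ≤ Qp p Ω V₂ u := by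
    intro u hu
    have := aux_diff (η := 0) hp hopen hV₁ hV₂ hle hu ∅ MeasurableSet.empty (by simp)
    linarith
  have hnn2 : NonnegOn p Ω V₂ := fun u hu => (hnn u hu).trans (hQ12 u hu)
  have hRex : ∀ x ∈ Ω, ∃ R, 0 < R ∧ R ≤ 1 ∧ Metric.closedBall x (2 * R) ⊆ Ω := by
    intro x hx
    obtain ⟨ε, hε, h⟩ := Metric.isOpen_iff.1 hopen x hx
    refine ⟨min 1 (ε / 4), lt_min one_pos (by linarith), min_le_left _ _, ?_⟩
    refine subset_trans (Metric.closedBall_subset_ball ?_) h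
    have := min_le_right 1 (ε / 4)
    linarith
  have hmain : ∀ x R, 0 < R → R ≤ 1 → Metric.closedBall x (2 * R) ⊆ Ω → ∀ G : Set (Ed d),
      MeasurableSet G → G ⊆ Metric.ball x R → 0 < volume G → ∀ CG : ℝ, 0 ≤ CG →
      (∀ (u : Ed d → ℝ) (s : ℝ), IsTestOn Ω u → 0 < s → Qp p Ω V₂ u ≤ s →
        ∫ z in G, |u z| ^ p ≤ CG * s) → ∃ r C, AuxGood p Ω V₂ x r C := by
    intro x R hR hR1 hsub G hGm hG hGpos CG hCG h
    have hGt : volume G ≠ ⊤ := (lt_of_le_of_lt (measure_mono hG) measure_ball_lt_top).ne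
    obtain ⟨C, hC, hh⟩ := aux_main p hp d Ω V₁ hV₁ hnn x R hR hR1 hsub G hGm hG
      (ENNReal.toReal_pos hGpos.ne' hGt) CG hCG
    exact ⟨R / 4, C, by linarith, hC, fun u s hu hs hQ =>
      hh u s hu hs ((hQ12 u hu).trans hQ) (h u s hu hs hQ)⟩
  set S : Set (Ed d) := {x | x ∈ Ω ∧ ∃ r C, AuxGood p Ω V₂ x r C} with hS
  have hSmem : ∀ x, x ∈ S ↔ (x ∈ Ω ∧ ∃ r C, AuxGood p Ω V₂ x r C) := fun x => Iff.rfl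
  have hSopen : IsOpen S := by
    rw [Metric.isOpen_iff]
    intro x hx
    obtain ⟨hxΩ, r, C, hg⟩ := hx
    obtain ⟨ε, hε, h⟩ := Metric.isOpen_iff.1 hopen x hxΩ
    refine ⟨min ε r, lt_min hε hg.1, fun y hy => ?_⟩
    rw [Metric.mem_ball] at hy
    have h1 : dist y x < ε := hy.trans_le (min_le_left _ _)
    have h2 : dist y x < r := hy.trans_le (min_le_right _ _)
    refine ⟨h h1, r - dist y x, C, aux_good_mono hp hg (by linarith) ?_⟩
    exact Metric.ball_subset_ball' (by linarith)
  have hSclosed : closure S ∩ Ω ⊆ S := by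
    rintro x ⟨hxS, hxΩ⟩
    obtain ⟨R, hR, hR1, hsub⟩ := hRex x hxΩ
    obtain ⟨y, ⟨hyΩ, r, C, hg⟩, hxy⟩ := Metric.mem_closure_iff.1 hxS R hR
    refine ⟨hxΩ, ?_⟩
    have hr' : 0 < min r (R - dist x y) := lt_min hg.1 (by linarith)
    have hg' := aux_good_mono (y := y) hp hg hr' (Metric.ball_subset_ball (min_le_left _ _))
    refine hmain x R hR hR1 hsub (Metric.ball y (min r (R - dist x y)))
      Metric.isOpen_ball.measurableSet ?_ (Metric.measure_ball_pos _ _ hr') C hg'.2.1 hg'.2.2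
    apply Metric.ball_subset_ball'
    have := min_le_right r (R - dist x y)
    rw [dist_comm y x]
    linarith
  have hSne : (Ω ∩ S).Nonempty := by
    set E : ℕ → Set (Ed d) := fun n => {x | x ∈ Ω ∧ V₁ x + 1 / ((n : ℝ) + 1) ≤ V₂ x} with hE
    have hEm : ∀ n, MeasurableSet (E n) := fun n =>
      hopen.measurableSet.inter (measurableSet_le (hV₁.1.add_const _) hV₂.1)
    obtain ⟨n, hn⟩ : ∃ n, volume (E n) ≠ 0 := by
      by_contra hcon
      push Not at hcon
      have h0 := measure_iUnion_null hcon
      rw [ae_restrict_iff' hopen.measurableSet] at hle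
      refine hne.ne' ?_
      rw [← nonpos_iff_eq_zero, ← h0]
      apply measure_mono_ae
      filter_upwards [hle] with x hx hx2
      obtain ⟨hxΩ, hxne⟩ := hx2
      have hlt : V₁ x < V₂ x := lt_of_le_of_ne (hx hxΩ) hxne
      obtain ⟨n, hn⟩ := exists_nat_one_div_lt (sub_pos.2 hlt)
      exact Set.mem_iUnion.2 ⟨n, hxΩ, by linarith⟩
    obtain ⟨x, hxE, hx⟩ := exists_mem_forall_mem_nhdsWithin_pos_measure hn
    obtain ⟨R, hR, hR1, hsub⟩ := hRex x hxE.1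
    refine ⟨x, hxE.1, hxE.1, ?_⟩
    have hpos : 0 < volume (Metric.ball x R ∩ E n) :=
      hx _ (Filter.inter_mem (mem_nhdsWithin_of_mem_nhds (Metric.ball_mem_nhds x hR)) self_mem_nhdsWithin)
    refine hmain x R hR hR1 hsub (Metric.ball x R ∩ E n)
      (Metric.isOpen_ball.measurableSet.inter (hEm n)) Set.inter_subset_left hpos ((n : ℝ) + 1)
      (by positivity) ?_
    intro u s hu hs hQ
    have h1 := aux_diff (η := 1 / ((n : ℝ) + 1)) hp hopen hV₁ hV₂ hle hu (Metric.ball x R ∩ E n)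
      (Metric.isOpen_ball.measurableSet.inter (hEm n)) (fun z hz => hz.2.2)
    have h2 := hnn u hu
    have h3 : 1 / ((n : ℝ) + 1) * (∫ z in Metric.ball x R ∩ E n, |u z| ^ p) ≤ s := by linarith
    rw [div_mul_eq_mul_div, one_mul, div_le_iff₀ (by positivity)] at h3
    linarith
  have hall : Ω ⊆ S := hconn.isPreconnected.subset_of_closure_inter_subset hSopen hSne hSclosed
  exact aux_assemble hp hconn.nonempty hnn2 (fun x hx => (hall hx).2)

/-- Proposition 13.8 (monotonicity in the potential): if `V₁ ≤ V₂` a.e. in Ω,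
`V₁ ≠ V₂` on a set of positive measure, and `Q_{V₁} ≥ 0` in Ω, then `Q_{V₂}` is
subcritical in Ω. -/
theorem stmt15 (d : ℕ) (p : ℝ) (hp : 1 < p) (Ω : Set (Ed d))
    (hopen : IsOpen Ω) (hconn : IsConnected Ω)
    (V₁ V₂ : Ed d → ℝ) (hV₁ : LocBddOn Ω V₁) (hV₂ : LocBddOn Ω V₂)
    (hle : ∀ᵐ x ∂(volume.restrict Ω), V₁ x ≤ V₂ x)
    (hne : 0 < volume {x ∈ Ω | V₁ x ≠ V₂ x})
    (hnn : NonnegOn p Ω V₁) :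
    SubcriticalOn p Ω V₂ := by
  exact aux_stmt d p hp Ω hopen hconn V₁ V₂ hV₁ hV₂ hle hne hnn
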